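/- Let G be a triangle-free plane graph whose outer face is F, let P ⊆ F be a subpath of the boundary of F containing at most two vertices, and let L be a (*,1)-list assignment on G satisfying: (i) |L(v)| ≥ 3 for every v ∈ V(G)\V(F); (ii) |L(v)| ≥ 2 for every v ∈ V(F)\V(P); (iii) |L(v)| = 1 for every v ∈ V(P); (iv) no two vertices with lists of size two are adjacent in G; (v) the subgraph of G induced by V(P) is L-colorable. Then G is L-colorable. -/

import Mathlib

open Set

namespace ChoosSep

/-- `G` has a cycle of length `n`. -/
def HasCycleLen {V : Type} (G : SimpleGraph V) (n : ℕ) : Prop :=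
  ∃ (v : V) (c : G.Walk v v), c.IsCycle ∧ c.length = n

/-- `G` has a proper coloring choosing each color from the list `L v`. -/
def ColorableWith {V : Type} (G : SimpleGraph V) (L : V → Finset ℕ) : Prop :=
  ∃ φ : V → ℕ, (∀ v, φ v ∈ L v) ∧ ∀ ⦃u v⦄, G.Adj u v → φ u ≠ φ v

/-- `G` is `(k,d)`-choosable: it has an `L`-coloring for every list assignment
giving each vertex at least `k` colors and any two adjacent vertices at most `d`
common colors. -/
def Choosable {V : Type} (G : SimpleGraph V) (k d : ℕ) : Prop :=
  ∀ L : V → Finset ℕ, (∀ v, k ≤ (L v).card) →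
    (∀ ⦃u v⦄, G.Adj u v → ((L u) ∩ (L v)).card ≤ d) →
    ColorableWith G L

/-- The closed straight segment between two points of the plane. -/
def seg (x y : ℝ × ℝ) : Set (ℝ × ℝ) := segment ℝ x y

/-- A straight-line plane embedding of `G`: vertices go to distinct points, edges are
drawn as straight segments, two distinct edges meet only in common endpoints, and no
vertex lies on the drawing of an edge it does not belong to.  By Fáry's theorem a
finite simple graph admits such an embedding iff it is planar. -/
structure PlaneEmb {V : Type} (G : SimpleGraph V) where
  pos : V → ℝ × ℝ
  inj : Function.Injective pos
  edges_meet : ∀ ⦃a b c d : V⦄, G.Adj a b → G.Adj c d → s(a, b) ≠ s(c, d) →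
    seg (pos a) (pos b) ∩ seg (pos c) (pos d) ⊆ ({pos a, pos b} ∩ {pos c, pos d} : Set (ℝ × ℝ))
  vertex_off : ∀ ⦃a b v : V⦄, G.Adj a b → v ≠ a → v ≠ b → pos v ∉ seg (pos a) (pos b)

/-- `G` is planar: it admits a plane embedding. -/
def IsPlanar {V : Type} (G : SimpleGraph V) : Prop := Nonempty (PlaneEmb G)

variable {V : Type} {G : SimpleGraph V}

/-- The drawing of the graph in the plane: all vertex points and all edge segments. -/
def PlaneEmb.drawing (E : PlaneEmb G) : Set (ℝ × ℝ) :=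
  Set.range E.pos ∪ ⋃ (a : V) (b : V) (_ : G.Adj a b), seg (E.pos a) (E.pos b)

/-- A face of the embedding: a connected component of the complement of the drawing. -/
def PlaneEmb.IsFace (E : PlaneEmb G) (C : Set (ℝ × ℝ)) : Prop :=
  ∃ q, q ∉ E.drawing ∧ C = connectedComponentIn E.drawingᶜ q

/-- The outer face: the unbounded face. -/
def PlaneEmb.IsOuterFace (E : PlaneEmb G) (C : Set (ℝ × ℝ)) : Prop :=
  E.IsFace C ∧ ¬ Bornology.IsBounded C

/-- The vertices lying on the boundary of the face `C`. -/
def PlaneEmb.onFace (E : PlaneEmb G) (C : Set (ℝ × ℝ)) : Set V :=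
  {v | E.pos v ∈ closure C}

/-- An edge of `G` lying on the boundary of the face `C`. -/
def PlaneEmb.BoundaryEdge (E : PlaneEmb G) (C : Set (ℝ × ℝ)) (u v : V) : Prop :=
  G.Adj u v ∧ seg (E.pos u) (E.pos v) ⊆ closure C

/-- `C` is a 3-face with (mutually adjacent) incident vertices `x`, `y`, `z`. -/
def PlaneEmb.IsTriFace (E : PlaneEmb G) (C : Set (ℝ × ℝ)) (x y z : V) : Prop :=
  E.IsFace C ∧ G.Adj x y ∧ G.Adj y z ∧ G.Adj x z ∧
    frontier C = seg (E.pos x) (E.pos y) ∪ seg (E.pos y) (E.pos z) ∪ seg (E.pos x) (E.pos z)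

/-- `C` is a 4-face with incident 4-cycle `w x y z`. -/
def PlaneEmb.IsQuadFace (E : PlaneEmb G) (C : Set (ℝ × ℝ)) (w x y z : V) : Prop :=
  E.IsFace C ∧ G.Adj w x ∧ G.Adj x y ∧ G.Adj y z ∧ G.Adj z w ∧ w ≠ y ∧ x ≠ z ∧
    frontier C = seg (E.pos w) (E.pos x) ∪ seg (E.pos x) (E.pos y) ∪
      seg (E.pos y) (E.pos z) ∪ seg (E.pos z) (E.pos w)

/-- `x z1 y z2` is a diamond: a 4-cycle formed by two adjacent 3-faces
`x y z1` and `x y z2` sharing the edge `x y`. -/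
def PlaneEmb.IsDiamond (E : PlaneEmb G) (x z1 y z2 : V) : Prop :=
  z1 ≠ z2 ∧ ∃ C1 C2 : Set (ℝ × ℝ), C1 ≠ C2 ∧ E.IsTriFace C1 x y z1 ∧ E.IsTriFace C2 x y z2

/-- The union of the three sides of the triangle `a b c`. -/
def triBoundary (a b c : ℝ × ℝ) : Set (ℝ × ℝ) := seg a b ∪ seg b c ∪ seg a c

/-- The open interior region of the triangle `a b c`: points off the triangle whose
connected component in the complement of the triangle is bounded. -/
def triInterior (a b c : ℝ × ℝ) : Set (ℝ × ℝ) :=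
  {p | p ∉ triBoundary a b c ∧
    Bornology.IsBounded (connectedComponentIn (triBoundary a b c)ᶜ p)}

/-- The degree of a vertex. -/
noncomputable def deg (G : SimpleGraph V) (v : V) : ℕ := Nat.card {u : V // G.Adj v u}

/-- `G` is 2-connected: connected and with no cutvertex. -/
def TwoConnected (G : SimpleGraph V) : Prop :=
  G.Connected ∧ ∀ v : V, (G.induce {u : V | u ≠ v}).Connected

/-- The line spanned by a straight edge from `e.1` to `e.2`, as a function of the abscissa. -/
noncomputable def line {V : Type} (X Y : V → ℝ) (e : V × V) (x : ℝ) : ℝ :=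
  Y e.1 + (Y e.2 - Y e.1) / (X e.2 - X e.1) * (x - X e.1)

/-- A finite straight-line drawing in which all vertices have distinct abscissas; every edge
is listed once, directed from left to right. -/
structure Drawing (V : Type) where
  X : V → ℝ
  Y : V → ℝ
  D : Finset (V × V)
  inj : Function.Injective X
  lt : ∀ e ∈ D, X e.1 < X e.2
  meet : ∀ e ∈ D, ∀ e' ∈ D, e ≠ e' → ∀ x, X e.1 ≤ x → x ≤ X e.2 → X e'.1 ≤ x → x ≤ X e'.2 →
    line X Y e x = line X Y e' x → (x = X e.1 ∨ x = X e.2) ∧ (x = X e'.1 ∨ x = X e'.2)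

open Classical in
/-- Partial sums `T + ∑_{s j > s i} a j` and `T + ∑_{s j ≥ s i} a j` telescope mod 2. -/
lemma telescope {ι M : Type*} [AddCommGroup M] (R : Finset ι) (s : ι → ℝ)
    (hs : Set.InjOn s R) (a : ι → M) (T : M) (δ : M → ZMod 2) :
    ∑ i ∈ R, (δ (T + ∑ j ∈ R.filter (fun j => s i < s j), a j) +
      δ (T + ∑ j ∈ R.filter (fun j => s i < s j), a j + a i)) = δ T + δ (T + ∑ i ∈ R, a i) := by
  have h2 : ∀ x : ZMod 2, x + x = 0 := by decide
  induction R using Finset.induction_on_min_value s with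
  | empty => simp [h2]
  | insert m R hm hmin ih =>
    have hlt : ∀ x ∈ R, s m < s x := fun x hx => lt_of_le_of_ne (hmin x hx) fun h => by
      have := hs (by simp) (by simp [hx]) h
      exact hm (this ▸ hx)
    rw [Finset.sum_insert hm, Finset.sum_insert hm]
    have e1 : (insert m R).filter (fun j => s m < s j) = R := by
      ext j
      simp only [Finset.mem_filter, Finset.mem_insert]
      constructor
      · rintro ⟨rfl | h, h'⟩
        · exact absurd h' (lt_irrefl _)
        · exact h
      · exact fun h => ⟨Or.inr h, hlt j h⟩
    have e2 : ∀ i ∈ R, (insert m R).filter (fun j => s i < s j) =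
        R.filter (fun j => s i < s j) := by
      intro i hi
      rw [Finset.filter_insert, if_neg (not_lt.2 (hmin i hi))]
    have e3 : ∀ i ∈ R, δ (T + ∑ j ∈ (insert m R).filter (fun j => s i < s j), a j) +
        δ (T + ∑ j ∈ (insert m R).filter (fun j => s i < s j), a j + a i) =
        δ (T + ∑ j ∈ R.filter (fun j => s i < s j), a j) +
        δ (T + ∑ j ∈ R.filter (fun j => s i < s j), a j + a i) := fun i hi => by rw [e2 i hi]
    rw [Finset.sum_congr rfl e3, ih (hs.mono (by simp)), e1, add_comm (a m), ← add_assoc T]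
    linear_combination h2 (δ (T + ∑ i ∈ R, a i))

namespace Drawing

open Filter Topology

variable (Δ : Drawing V)

/-- The height of the edge `e` at abscissa `x`. -/
noncomputable def ht (e : V × V) (x : ℝ) : ℝ := line Δ.X Δ.Y e x

/-- The slope of an edge. -/
noncomputable def slope (e : V × V) : ℝ := (Δ.Y e.2 - Δ.Y e.1) / (Δ.X e.2 - Δ.X e.1)

lemma ht_eq (e : V × V) (x : ℝ) : Δ.ht e x = Δ.Y e.1 + Δ.slope e * (x - Δ.X e.1) := rfl

lemma ht_left (e : V × V) : Δ.ht e (Δ.X e.1) = Δ.Y e.1 := by simp [ht_eq]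

lemma ht_eq' {e : V × V} (he : e ∈ Δ.D) (x : ℝ) :
    Δ.ht e x = Δ.Y e.2 + Δ.slope e * (x - Δ.X e.2) := by
  have h := Δ.lt e he
  have h' : Δ.X e.2 - Δ.X e.1 ≠ 0 := by linarith
  rw [ht_eq, slope]
  field_simp
  ring

lemma ht_right {e : V × V} (he : e ∈ Δ.D) : Δ.ht e (Δ.X e.2) = Δ.Y e.2 := by
  simp [Δ.ht_eq' he]

lemma continuous_ht (e : V × V) : Continuous (Δ.ht e) := by
  have : Δ.ht e = fun x => Δ.Y e.1 + Δ.slope e * (x - Δ.X e.1) := rfl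
  rw [this]; fun_prop

/-- The edge `e'` runs above the edge `e`. -/
def Above (e' e : V × V) : Prop :=
  ∃ x, Δ.X e.1 < x ∧ x < Δ.X e.2 ∧ Δ.X e'.1 < x ∧ x < Δ.X e'.2 ∧ Δ.ht e x < Δ.ht e' x

lemma sign_const {e e' : V × V} (he : e ∈ Δ.D) (he' : e' ∈ Δ.D) {x y : ℝ}
    (hx1 : Δ.X e.1 ≤ x) (hx2 : x ≤ Δ.X e.2) (hx3 : Δ.X e'.1 ≤ x) (hx4 : x ≤ Δ.X e'.2)
    (hy1 : Δ.X e.1 ≤ y) (hy2 : y ≤ Δ.X e.2) (hy3 : Δ.X e'.1 ≤ y) (hy4 : y ≤ Δ.X e'.2)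
    (hx : Δ.ht e x < Δ.ht e' x) : Δ.ht e y ≤ Δ.ht e' y := by
  by_contra! hy
  have hne : e ≠ e' := by rintro rfl; exact lt_irrefl _ hx
  have hc : ContinuousOn (fun u => Δ.ht e' u - Δ.ht e u) (Set.uIcc x y) :=
    ((Δ.continuous_ht e').sub (Δ.continuous_ht e)).continuousOn
  obtain ⟨u, hu, hu0⟩ := intermediate_value_uIcc hc
    (show (0 : ℝ) ∈ _ from by
      rw [Set.mem_uIcc]; right; constructor <;> linarith)
  have hux : u ≠ x := by rintro rfl; simp only at hu0; linarith
  have huy : u ≠ y := by rintro rfl; simp only at hu0; linarith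
  simp only at hu0
  rw [Set.mem_uIcc] at hu
  have key : Δ.X e.1 < u ∧ u < Δ.X e.2 ∧ Δ.X e'.1 < u ∧ u < Δ.X e'.2 := by
    rcases hu with ⟨h1, h2⟩ | ⟨h1, h2⟩
    · have := lt_of_le_of_ne h1 hux.symm
      have := lt_of_le_of_ne h2 huy
      refine ⟨?_, ?_, ?_, ?_⟩ <;> linarith
    · have := lt_of_le_of_ne h1 huy.symm
      have := lt_of_le_of_ne h2 hux
      refine ⟨?_, ?_, ?_, ?_⟩ <;> linarith
  obtain ⟨k1, k2, k3, k4⟩ := key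
  have := (Δ.meet e he e' he' hne u k1.le k2.le k3.le k4.le
    (show Δ.ht e u = Δ.ht e' u by linarith)).1
  rcases this with h | h <;> linarith

lemma above_iff {e e' : V × V} (he : e ∈ Δ.D) (he' : e' ∈ Δ.D) {x : ℝ}
    (h1 : Δ.X e.1 ≤ x) (h2 : x ≤ Δ.X e.2) (h3 : Δ.X e'.1 ≤ x) (h4 : x ≤ Δ.X e'.2)
    (h5 : Δ.X e.1 < Δ.X e'.2) (h6 : Δ.X e'.1 < Δ.X e.2)
    (hx : x ≠ Δ.X e.1 ∧ x ≠ Δ.X e.2 ∨ x ≠ Δ.X e'.1 ∧ x ≠ Δ.X e'.2) :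
    Δ.Above e' e ↔ Δ.ht e x < Δ.ht e' x := by
  by_cases hne : e = e'
  · subst hne; simp [Above]
  have hx0 : Δ.ht e x ≠ Δ.ht e' x := by
    intro h
    have := Δ.meet e he e' he' hne x h1 h2 h3 h4 h
    tauto
  constructor
  · rintro ⟨u, u1, u2, u3, u4, hu⟩
    exact lt_of_le_of_ne (Δ.sign_const he he' u1.le u2.le u3.le u4.le h1 h2 h3 h4 hu) hx0
  · intro h
    obtain ⟨u, hu1, hu2⟩ : ∃ u, max (Δ.X e.1) (Δ.X e'.1) < u ∧ u < min (Δ.X e.2) (Δ.X e'.2) := by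
      apply exists_between
      have := Δ.lt e he
      have := Δ.lt e' he'
      simp [*]
    rw [max_lt_iff] at hu1
    rw [lt_min_iff] at hu2
    refine ⟨u, hu1.1, hu2.1, hu1.2, hu2.2, lt_of_le_of_ne
      (Δ.sign_const he he' h1 h2 h3 h4 hu1.1.le hu2.1.le hu1.2.le hu2.2.le h) ?_⟩
    intro h
    have := (Δ.meet e he e' he' hne u hu1.1.le hu2.1.le hu1.2.le hu2.2.le h).1
    rcases this with h | h <;> linarith [hu1.1, hu2.1]

lemma above_iff_of_left {e e' : V × V} (he : e ∈ Δ.D) (he' : e' ∈ Δ.D) (h : e'.1 = e.1) :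
    Δ.Above e' e ↔ Δ.slope e < Δ.slope e' := by
  have key : ∀ x, Δ.X e.1 < x → (Δ.ht e x < Δ.ht e' x ↔ Δ.slope e < Δ.slope e') := by
    intro x hx
    rw [ht_eq, ht_eq, h, add_lt_add_iff_left, mul_lt_mul_iff_left₀ (by linarith)]
  constructor
  · rintro ⟨u, u1, -, -, -, hu⟩
    exact (key u u1).1 hu
  · intro hs
    obtain ⟨u, hu1, hu2⟩ : ∃ u, Δ.X e.1 < u ∧ u < min (Δ.X e.2) (Δ.X e'.2) := by
      apply exists_between
      have := Δ.lt e he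
      have := Δ.lt e' he'
      rw [h] at this
      simp [*]
    rw [lt_min_iff] at hu2
    exact ⟨u, hu1, hu2.1, h ▸ hu1, hu2.2, (key u hu1).2 hs⟩

lemma above_iff_of_right {e e' : V × V} (he : e ∈ Δ.D) (he' : e' ∈ Δ.D) (h : e'.2 = e.2) :
    Δ.Above e' e ↔ Δ.slope e' < Δ.slope e := by
  have key : ∀ x, x < Δ.X e.2 → (Δ.ht e x < Δ.ht e' x ↔ Δ.slope e' < Δ.slope e) := by
    intro x hx
    rw [Δ.ht_eq' he, Δ.ht_eq' he', h, add_lt_add_iff_left, mul_lt_mul_right_of_neg (by linarith)]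
  constructor
  · rintro ⟨u, -, u1, -, -, hu⟩
    exact (key u u1).1 hu
  · intro hs
    obtain ⟨u, hu1, hu2⟩ : ∃ u, max (Δ.X e.1) (Δ.X e'.1) < u ∧ u < Δ.X e.2 := by
      apply exists_between
      have := Δ.lt e he
      have := Δ.lt e' he'
      rw [h] at this
      simp [*]
    rw [max_lt_iff] at hu1
    exact ⟨u, hu1.1, hu2, hu1.2, h ▸ hu2, (key u hu2).2 hs⟩

lemma slope_injOn_left {e e' : V × V} (he : e ∈ Δ.D) (he' : e' ∈ Δ.D) (h : e'.1 = e.1)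
    (hs : Δ.slope e = Δ.slope e') : e = e' := by
  by_contra hne
  have h1 := Δ.lt e he
  have h2 := Δ.lt e' he'
  obtain ⟨u, hu1, hu2⟩ : ∃ u, Δ.X e.1 < u ∧ u < min (Δ.X e.2) (Δ.X e'.2) := by
    apply exists_between
    rw [h] at h2
    simp [*]
  rw [lt_min_iff] at hu2
  have := (Δ.meet e he e' he' hne u hu1.le hu2.1.le (h ▸ hu1.le) hu2.2.le
    (show Δ.ht e u = Δ.ht e' u by rw [ht_eq, ht_eq, h, hs])).1
  rcases this with h | h <;> linarith

lemma slope_injOn_right {e e' : V × V} (he : e ∈ Δ.D) (he' : e' ∈ Δ.D) (h : e'.2 = e.2)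
    (hs : Δ.slope e = Δ.slope e') : e = e' := by
  by_contra hne
  have h1 := Δ.lt e he
  have h2 := Δ.lt e' he'
  obtain ⟨u, hu1, hu2⟩ : ∃ u, max (Δ.X e.1) (Δ.X e'.1) < u ∧ u < Δ.X e.2 := by
    apply exists_between
    rw [h] at h2
    simp [*]
  rw [max_lt_iff] at hu1
  have := (Δ.meet e he e' he' hne u hu1.1.le hu2.le hu1.2.le (h ▸ hu2.le)
    (show Δ.ht e u = Δ.ht e' u by rw [Δ.ht_eq' he, Δ.ht_eq' he', h, hs])).1
  rcases this with h | h <;> linarith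

open Classical in
/-- The mod 2 boundary of a set of edges. -/
noncomputable def bd : (Δ.D → ZMod 2) →ₗ[ZMod 2] (V → ZMod 2) where
  toFun z v := ∑ e, z e * ((if e.1.1 = v then 1 else 0) + (if e.1.2 = v then 1 else 0))
  map_add' z w := by ext v; simp [add_mul, Finset.sum_add_distrib]
  map_smul' c z := by ext v; simp [Finset.mul_sum, mul_assoc]

/-- The space of even subgraphs. -/
noncomputable abbrev cyc : Submodule (ZMod 2) (Δ.D → ZMod 2) := LinearMap.ker Δ.bd

open Classical in
/-- The functional counting mod 2 the edges of an even subgraph that satisfy `p`. -/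
noncomputable def cnt (p : V × V → Prop) : Module.Dual (ZMod 2) Δ.cyc where
  toFun z := ∑ e : Δ.D, z.1 e * (if p e then 1 else 0)
  map_add' z w := by
    simp only [Submodule.coe_add, Pi.add_apply, add_mul, Finset.sum_add_distrib]
  map_smul' c z := by simp [Finset.mul_sum]

open Classical in
lemma cnt_apply (p : V × V → Prop) (z : Δ.cyc) :
    Δ.cnt p z = ∑ e : Δ.D, z.1 e * (if p e then 1 else 0) := rfl

variable {Δ}

lemma cnt_congr {p q : V × V → Prop} (h : ∀ e ∈ Δ.D, p e ↔ q e) : Δ.cnt p = Δ.cnt q := by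
  ext z
  rw [cnt_apply, cnt_apply]
  refine Finset.sum_congr rfl fun e _ => ?_
  have h1 := h e.1 e.2
  by_cases hp : p e.1 <;> simp_all

lemma cnt_eq_zero {p : V × V → Prop} (h : ∀ e ∈ Δ.D, ¬ p e) : Δ.cnt p = 0 := by
  ext z
  rw [cnt_apply]
  exact Finset.sum_eq_zero fun e _ => by simp [h e.1 e.2]

lemma cnt_add {p q r : V × V → Prop} (h : ∀ e ∈ Δ.D, r e ↔ p e ∨ q e)
    (h' : ∀ e ∈ Δ.D, p e → ¬ q e) : Δ.cnt r = Δ.cnt p + Δ.cnt q := by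
  ext z
  rw [LinearMap.add_apply, cnt_apply, cnt_apply, cnt_apply, ← Finset.sum_add_distrib]
  refine Finset.sum_congr rfl fun e _ => ?_
  have h1 := h e.1 e.2
  have h2 := h' e.1 e.2
  by_cases hp : p e.1 <;> by_cases hq : q e.1 <;> simp_all

open Classical in
lemma sum_cnt_single (s : Finset (V × V)) (hs : s ⊆ Δ.D) :
    ∑ e ∈ s, Δ.cnt (· = e) = Δ.cnt (· ∈ s) := by
  induction s using Finset.induction_on with
  | empty => symm; simpa using cnt_eq_zero (by simp)
  | insert a s ha ih =>
    rw [Finset.sum_insert ha, ih (fun x hx => hs (Finset.mem_insert_of_mem hx))]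
    symm
    refine cnt_add (by simp) ?_
    rintro e - rfl
    exact ha

lemma cnt_cut [Fintype V] (U : V → Prop) : Δ.cnt (fun e => ¬ (U e.1 ↔ U e.2)) = 0 := by
  classical
  ext z
  have hz : ∀ v, Δ.bd z.1 v = 0 := fun v => by
    rw [LinearMap.mem_ker.1 z.2]; rfl
  have h0 : ∑ v ∈ Finset.univ.filter U, Δ.bd z.1 v = 0 := Finset.sum_eq_zero fun v _ => hz v
  rw [cnt_apply, LinearMap.zero_apply]
  refine Eq.trans ?_ h0
  simp only [bd, LinearMap.coe_mk, AddHom.coe_mk]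
  rw [Finset.sum_comm]
  refine Finset.sum_congr rfl fun e _ => ?_
  rw [← Finset.mul_sum, Finset.sum_add_distrib]
  congr 1
  by_cases h1 : U e.1.1 <;> by_cases h2 : U e.1.2 <;> simp [h1, h2]
  decide

lemma cnt_eq_of_cut [Fintype V] {p q : V × V → Prop} (U : V → Prop)
    (h : ∀ e ∈ Δ.D, ((p e ↔ q e) ↔ (U e.1 ↔ U e.2))) : Δ.cnt p = Δ.cnt q := by
  classical
  have h0 := Δ.cnt_cut U
  ext z
  have := LinearMap.congr_fun h0 z
  rw [LinearMap.zero_apply, cnt_apply] at this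
  rw [cnt_apply, cnt_apply, ← sub_eq_zero, ← Finset.sum_sub_distrib, ← this]
  refine Finset.sum_congr rfl fun e _ => ?_
  have h1 := h e.1 e.2
  rw [← mul_sub]
  congr 1
  by_cases hp : p e.1 <;> by_cases hq : q e.1 <;> simp_all

/-- An edge lying in no even subgraph is the only edge across some cut. -/
lemma exists_cut_of_cnt_eq_zero {e : V × V} (he : e ∈ Δ.D) (h : Δ.cnt (· = e) = 0) :
    ∃ g : V → Prop, ∀ e' ∈ Δ.D, (g e'.1 ↔ g e'.2) ↔ e' ≠ e := by
  classical
  have hp : LinearMap.proj (⟨e, he⟩ : Δ.D) ∈ (LinearMap.ker Δ.bd).dualAnnihilator := by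
    rw [Submodule.mem_dualAnnihilator]
    intro z hz
    have := LinearMap.congr_fun h ⟨z, hz⟩
    rw [LinearMap.zero_apply, cnt_apply, Finset.sum_eq_single ⟨e, he⟩] at this
    · simpa using this
    · intro b _ hb
      have : b.1 ≠ e := fun h => hb (Subtype.ext h)
      simp [this]
    · simp
  rw [← LinearMap.range_dualMap_eq_dualAnnihilator_ker] at hp
  obtain ⟨f, hf⟩ := hp
  refine ⟨fun v => f (Pi.single v 1) = 1, fun e' he' => ?_⟩
  have h1 := LinearMap.congr_fun hf (Pi.single ⟨e', he'⟩ 1)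
  have h2 : Δ.bd (Pi.single ⟨e', he'⟩ 1) = Pi.single e'.1 1 + Pi.single e'.2 1 := by
    ext v
    simp only [bd, LinearMap.coe_mk, AddHom.coe_mk]
    rw [Finset.sum_eq_single ⟨e', he'⟩]
    · simp [Pi.single_apply, eq_comm]
    · intro b _ hb
      simp [hb]
    · simp
  rw [LinearMap.dualMap_apply, h2, map_add, LinearMap.proj_apply, Pi.single_apply] at h1
  have key : ∀ a b : ZMod 2, (a = 1 ↔ b = 1) ↔ a + b = 0 := by decide
  rw [key, h1]
  by_cases hh : e' = e
  · simp [hh]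
  · simp [hh, Ne.symm hh]

/-- Lower bound on the dimension of the space of even subgraphs. -/
lemma card_le_finrank_cyc [Fintype V] (S : Finset V) (hS : S.Nonempty)
    (hD : ∀ e ∈ Δ.D, e.1 ∈ S ∧ e.2 ∈ S) :
    Δ.D.card + 1 ≤ Module.finrank (ZMod 2) Δ.cyc + S.card := by
  classical
  obtain ⟨s, hs⟩ := hS
  let π : (V → ZMod 2) →ₗ[ZMod 2] ((S.erase s) → ZMod 2) := LinearMap.funLeft _ _ Subtype.val
  have hk : LinearMap.ker (π ∘ₗ Δ.bd) = Δ.cyc := by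
    refine le_antisymm ?_ (LinearMap.ker_le_ker_comp _ _)
    intro z hz
    rw [LinearMap.mem_ker] at hz ⊢
    have h1 : ∀ v ∈ S, v ≠ s → Δ.bd z v = 0 := fun v hv hvs =>
      congr_fun hz ⟨v, Finset.mem_erase.2 ⟨hvs, hv⟩⟩
    have h2 : ∀ v ∉ S, Δ.bd z v = 0 := by
      intro v hv
      simp only [bd, LinearMap.coe_mk, AddHom.coe_mk]
      refine Finset.sum_eq_zero fun e _ => ?_
      have h3 : e.1.1 ≠ v := fun h => hv (h ▸ (hD e.1 e.2).1)
      have h4 : e.1.2 ≠ v := fun h => hv (h ▸ (hD e.1 e.2).2)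
      simp [h3, h4]
    have h3 : ∑ v, Δ.bd z v = 0 := by
      simp only [bd, LinearMap.coe_mk, AddHom.coe_mk]
      rw [Finset.sum_comm]
      refine Finset.sum_eq_zero fun e _ => ?_
      rw [← Finset.mul_sum, Finset.sum_add_distrib]
      simp only [Finset.sum_ite_eq, Finset.mem_univ, if_true]
      rw [show (1 + 1 : ZMod 2) = 0 by decide, mul_zero]
    ext v
    by_cases hv : v ∈ S
    · by_cases hvs : v = s
      · subst hvs
        rw [Finset.sum_eq_single v] at h3
        · exact h3
        · intro b _ hb
          by_cases hbS : b ∈ S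
          · exact h1 b hbS hb
          · exact h2 b hbS
        · simp
      · exact h1 v hv hvs
    · exact h2 v hv
  have h1 := LinearMap.finrank_range_add_finrank_ker (π ∘ₗ Δ.bd)
  have h2 : Module.finrank (ZMod 2) (LinearMap.range (π ∘ₗ Δ.bd)) ≤ (S.erase s).card := by
    refine (Submodule.finrank_le _).trans ?_
    rw [Module.finrank_fintype_fun_eq_card, Fintype.card_coe]
  rw [hk, Module.finrank_fintype_fun_eq_card, Fintype.card_coe] at h1
  have h3 := Finset.card_erase_add_one hs
  omega

variable (Δ)

/-- Parity functional of the side of the edge `e` facing up. -/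
noncomputable def ab (e : V × V) : Module.Dual (ZMod 2) Δ.cyc :=
  Δ.cnt fun e' => Δ.X e'.1 ≤ Δ.X e.1 ∧ Δ.X e.1 < Δ.X e'.2 ∧ Δ.Above e' e

/-- Parity functional of the side of the edge `e` facing down. -/
noncomputable def be (e : V × V) : Module.Dual (ZMod 2) Δ.cyc := Δ.ab e + Δ.cnt (· = e)

/-- Parity functional counting the edges passing above the vertex `v`. -/
noncomputable def top (v : V) : Module.Dual (ZMod 2) Δ.cyc :=
  Δ.cnt fun e' => Δ.X e'.1 < Δ.X v ∧ Δ.X v < Δ.X e'.2 ∧ Δ.Y v < Δ.ht e' (Δ.X v)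

lemma ab_eq_right [Fintype V] {e : V × V} (he : e ∈ Δ.D) : Δ.ab e =
    Δ.cnt fun e' => Δ.X e'.1 < Δ.X e.2 ∧ Δ.X e.2 ≤ Δ.X e'.2 ∧ Δ.Above e' e := by
  refine cnt_eq_of_cut
    (fun v => Δ.X e.1 < Δ.X v ∧ Δ.X v < Δ.X e.2 ∧ Δ.ht e (Δ.X v) < Δ.Y v) ?_
  intro e' he'
  have l1 := Δ.lt e he
  have l2 := Δ.lt e' he'
  by_cases hc : Δ.X e.1 < Δ.X e'.2 ∧ Δ.X e'.1 < Δ.X e.2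
  · obtain ⟨c1, c2⟩ := hc
    have a1 : Δ.X e.1 < Δ.X e'.1 → (Δ.Above e' e ↔ Δ.ht e (Δ.X e'.1) < Δ.Y e'.1) := by
      intro h
      rw [← Δ.ht_left e']
      exact Δ.above_iff he he' h.le c2.le le_rfl l2.le c1 c2 (Or.inl ⟨h.ne', c2.ne⟩)
    have a2 : Δ.X e'.2 < Δ.X e.2 → (Δ.Above e' e ↔ Δ.ht e (Δ.X e'.2) < Δ.Y e'.2) := by
      intro h
      rw [← Δ.ht_right he']
      exact Δ.above_iff he he' c1.le h.le l2.le le_rfl c1 c2 (Or.inl ⟨c1.ne', h.ne⟩)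
    rcases lt_or_ge (Δ.X e.1) (Δ.X e'.1) with h1 | h1 <;>
    rcases lt_or_ge (Δ.X e'.2) (Δ.X e.2) with h2 | h2
    · simp only [c1, c2, h1, h2, ← a1 h1, ← a2 h2, not_le.2 h1, not_le.2 h2]; tauto
    · simp only [c1, c2, h1, h2, ← a1 h1, not_le.2 h1, not_lt.2 h2]; tauto
    · simp only [c1, c2, h1, h2, ← a2 h2, not_le.2 h2, not_lt.2 h1]; tauto
    · simp only [c1, c2, h1, h2, not_lt.2 h1, not_lt.2 h2]; tauto
  · have na : ¬ Δ.Above e' e := by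
      rintro ⟨u, u1, u2, u3, u4, -⟩
      exact hc ⟨by linarith, by linarith⟩
    rw [not_and_or, not_lt, not_lt] at hc
    rcases hc with hc | hc
    · have : ¬ Δ.X e.1 < Δ.X e'.1 := by linarith
      simp [na, not_lt.2 hc, this]
    · have : ¬ Δ.X e'.2 < Δ.X e.2 := by linarith
      simp [na, not_lt.2 hc, this]

open Classical in
lemma ab_at_left {e : V × V} (he : e ∈ Δ.D) : Δ.ab e = Δ.top e.1 +
    ∑ e' ∈ (Δ.D.filter (·.1 = e.1)).filter (fun e' => Δ.slope e < Δ.slope e'),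
      Δ.cnt (· = e') := by
  rw [sum_cnt_single _ ((Finset.filter_subset _ _).trans (Finset.filter_subset _ _))]
  have l1 := Δ.lt e he
  refine cnt_add ?_ ?_
  · intro e' he'
    have l2 := Δ.lt e' he'
    simp only [Finset.mem_filter, he', true_and]
    rcases lt_trichotomy (Δ.X e'.1) (Δ.X e.1) with h | h | h
    · have hne : e'.1 ≠ e.1 := fun hh => by rw [hh] at h; exact lt_irrefl _ h
      simp only [h, h.le, hne, true_and, false_and, or_false]
      refine and_congr_right fun h' => ?_
      rw [Δ.above_iff he he' le_rfl l1.le h.le h'.le h' (by linarith) (Or.inr ⟨h.ne', h'.ne⟩),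
        ht_left]
    · have hne : e'.1 = e.1 := Δ.inj h
      have l3 := l2
      rw [h] at l3
      simp only [hne, lt_irrefl, le_refl, l3, true_and, false_and, false_or]
      exact Δ.above_iff_of_left he he' hne
    · have hne : e'.1 ≠ e.1 := fun hh => by rw [hh] at h; exact lt_irrefl _ h
      simp [not_le.2 h, not_lt.2 h.le, hne]
  · rintro e' he' ⟨h1, -⟩ h2
    simp only [Finset.mem_filter] at h2
    rw [h2.1.2] at h1
    exact lt_irrefl _ h1

open Classical in
lemma ab_at_right [Fintype V] {e : V × V} (he : e ∈ Δ.D) : Δ.ab e = Δ.top e.2 +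
    ∑ e' ∈ (Δ.D.filter (·.2 = e.2)).filter (fun e' => -Δ.slope e < -Δ.slope e'),
      Δ.cnt (· = e') := by
  rw [sum_cnt_single _ ((Finset.filter_subset _ _).trans (Finset.filter_subset _ _)),
    Δ.ab_eq_right he]
  have l1 := Δ.lt e he
  refine cnt_add ?_ ?_
  · intro e' he'
    have l2 := Δ.lt e' he'
    simp only [Finset.mem_filter, he', true_and, neg_lt_neg_iff]
    rcases lt_trichotomy (Δ.X e.2) (Δ.X e'.2) with h | h | h
    · have hne : e'.2 ≠ e.2 := fun hh => by rw [hh] at h; exact lt_irrefl _ h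
      simp only [h, h.le, hne, true_and, false_and, or_false]
      refine and_congr_right fun h' => ?_
      rw [Δ.above_iff he he' l1.le le_rfl h'.le h.le (by linarith) h' (Or.inr ⟨h'.ne', h.ne⟩),
        Δ.ht_right he]
    · have hne : e'.2 = e.2 := Δ.inj h.symm
      have l3 := l2
      rw [← h] at l3
      simp only [hne, lt_irrefl, le_refl, l3, true_and, false_and, false_or, and_false]
      exact Δ.above_iff_of_right he he' hne
    · have hne : e'.2 ≠ e.2 := fun hh => by rw [hh] at h; exact lt_irrefl _ h
      simp [not_le.2 h, not_lt.2 h.le, hne]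
  · rintro e' he' ⟨-, h1, -⟩ h2
    simp only [Finset.mem_filter] at h2
    rw [h2.1.2] at h1
    exact lt_irrefl _ h1

open Classical in
lemma sum_cnt_right_eq_left [Fintype V] (v : V) :
    ∑ e ∈ Δ.D.filter (·.1 = v), Δ.cnt (· = e) = ∑ e ∈ Δ.D.filter (·.2 = v), Δ.cnt (· = e) := by
  rw [sum_cnt_single _ (Finset.filter_subset _ _), sum_cnt_single _ (Finset.filter_subset _ _)]
  refine cnt_eq_of_cut (· = v) fun e he => ?_
  simp [he]

open Classical in
/-- Going around a vertex one meets every set of sides an even number of times. -/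
lemma sum_sides_eq_zero [Fintype V] (v : V) (δ : Module.Dual (ZMod 2) Δ.cyc → ZMod 2) :
    ∑ e ∈ Δ.D.filter (fun e => e.1 = v ∨ e.2 = v), (δ (Δ.ab e) + δ (Δ.be e)) = 0 := by
  have h2 : ∀ x : ZMod 2, x + x = 0 := by decide
  have hR := telescope (Δ.D.filter (·.1 = v)) Δ.slope (by
    intro e he e' he' h
    simp only [Finset.mem_coe, Finset.mem_filter] at he he'
    exact Δ.slope_injOn_left he.1 he'.1 (he'.2.trans he.2.symm) h)
    (fun e => Δ.cnt (· = e)) (Δ.top v) δ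
  have hL := telescope (Δ.D.filter (·.2 = v)) (fun e => - Δ.slope e) (by
    intro e he e' he' h
    simp only [Finset.mem_coe, Finset.mem_filter] at he he'
    exact Δ.slope_injOn_right he.1 he'.1 (he'.2.trans he.2.symm) (neg_inj.1 h))
    (fun e => Δ.cnt (· = e)) (Δ.top v) δ
  rw [← sum_cnt_right_eq_left] at hL
  rw [Finset.filter_or, Finset.sum_union]
  · have eR : ∀ e ∈ Δ.D.filter (·.1 = v), δ (Δ.ab e) + δ (Δ.be e) =
        δ (Δ.top v + ∑ j ∈ (Δ.D.filter (·.1 = v)).filter (fun j => Δ.slope e < Δ.slope j),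
          Δ.cnt (· = j)) + δ (Δ.top v +
        ∑ j ∈ (Δ.D.filter (·.1 = v)).filter (fun j => Δ.slope e < Δ.slope j),
          Δ.cnt (· = j) + Δ.cnt (· = e)) := by
      intro e he
      obtain ⟨heD, rfl⟩ := Finset.mem_filter.1 he
      rw [be, Δ.ab_at_left heD]
    have eL : ∀ e ∈ Δ.D.filter (·.2 = v), δ (Δ.ab e) + δ (Δ.be e) =
        δ (Δ.top v + ∑ j ∈ (Δ.D.filter (·.2 = v)).filter (fun j => -Δ.slope e < -Δ.slope j),
          Δ.cnt (· = j)) + δ (Δ.top v +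
        ∑ j ∈ (Δ.D.filter (·.2 = v)).filter (fun j => -Δ.slope e < -Δ.slope j),
          Δ.cnt (· = j) + Δ.cnt (· = e)) := by
      intro e he
      obtain ⟨heD, rfl⟩ := Finset.mem_filter.1 he
      rw [be, Δ.ab_at_right heD]
    rw [Finset.sum_congr rfl eR, Finset.sum_congr rfl eL, hR, hL, h2]
  · rw [Finset.disjoint_left]
    intro e he he'
    obtain ⟨he, h⟩ := Finset.mem_filter.1 he
    obtain ⟨-, h'⟩ := Finset.mem_filter.1 he'
    have := Δ.lt e he
    rw [h, h'] at this
    exact lt_irrefl _ this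

open Classical in
/-- The edges having a side with parity functional `φ`. -/
noncomputable def face (φ : Module.Dual (ZMod 2) Δ.cyc) : Finset (V × V) :=
  Δ.D.filter fun e => Δ.ab e = φ ∨ Δ.be e = φ

variable {Δ}

lemma ab_ne_be {e : V × V} (h : Δ.cnt (· = e) ≠ 0) : Δ.ab e ≠ Δ.be e := by
  intro h'
  rw [be, left_eq_add] at h'
  exact h h'

lemma exists_ne_mem_face [Fintype V] (hbr : ∀ e ∈ Δ.D, Δ.cnt (· = e) ≠ 0) {φ : Module.Dual (ZMod 2) Δ.cyc}
    {e : V × V} (he : e ∈ Δ.face φ) {v : V} (hv : e.1 = v ∨ e.2 = v) :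
    ∃ e' ∈ Δ.face φ, e' ≠ e ∧ (e'.1 = v ∨ e'.2 = v) := by
  classical
  by_contra! hcon
  have h := Δ.sum_sides_eq_zero v (fun ψ => if ψ = φ then 1 else 0)
  obtain ⟨heD, hφ⟩ := Finset.mem_filter.1 he
  rw [Finset.sum_eq_single e] at h
  · have := ab_ne_be (hbr e heD)
    rcases hφ with rfl | rfl
    · simp [this.symm] at h
    · simp [this] at h
  · intro b hb hbe
    obtain ⟨hbD, hbv⟩ := Finset.mem_filter.1 hb
    have : b ∉ Δ.face φ := fun hbf => by
      have := hcon b hbf hbe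
      tauto
    have : ¬ (Δ.ab b = φ ∨ Δ.be b = φ) := fun h => this (Finset.mem_filter.2 ⟨hbD, h⟩)
    rw [not_or] at this
    simp [this]
  · intro h'
    exact absurd (Finset.mem_filter.2 ⟨heD, hv⟩) h'

/-- `u` and `v` are joined by an edge. -/
def Joined (Δ : Drawing V) (u v : V) : Prop := (u, v) ∈ Δ.D ∨ (v, u) ∈ Δ.D

lemma eq_of_common_ends {e e' : V × V} (he : e ∈ Δ.D) (he' : e' ∈ Δ.D) {u v : V} (huv : u ≠ v)
    (h1 : e.1 = u ∨ e.2 = u) (h2 : e.1 = v ∨ e.2 = v) (h3 : e'.1 = u ∨ e'.2 = u)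
    (h4 : e'.1 = v ∨ e'.2 = v) : e = e' := by
  have l1 := Δ.lt e he
  have l2 := Δ.lt e' he'
  obtain ⟨a, b⟩ := e
  obtain ⟨c, d⟩ := e'
  simp only at *
  rcases h1 with rfl | rfl <;> rcases h2 with rfl | rfl <;>
    first
    | exact absurd rfl huv
    | rcases h3 with rfl | rfl <;> rcases h4 with h4 | h4 <;>
        first
        | exact absurd h4 huv
        | exact absurd h4 huv.symm
        | (subst h4; first | rfl | exact absurd l2 l1.not_gt)

lemma exists_other_end {e : V × V} (he : e ∈ Δ.D) {u : V} (h : e.1 = u ∨ e.2 = u) :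
    ∃ v, v ≠ u ∧ (e.1 = v ∨ e.2 = v) ∧ Δ.Joined u v := by
  have hne : e.1 ≠ e.2 := fun h => by
    have := Δ.lt e he
    rw [h] at this
    exact lt_irrefl _ this
  rcases h with rfl | rfl
  · exact ⟨e.2, hne.symm, Or.inr rfl, Or.inl he⟩
  · exact ⟨e.1, hne, Or.inl rfl, Or.inr he⟩

lemma four_le_card_face [Fintype V]
    (htri : ∀ a b c, Δ.Joined a b → Δ.Joined b c → Δ.Joined a c → False)
    (hbr : ∀ e ∈ Δ.D, Δ.cnt (· = e) ≠ 0) {φ : Module.Dual (ZMod 2) Δ.cyc}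
    {e : V × V} (he : e ∈ Δ.face φ) : 4 ≤ (Δ.face φ).card := by
  classical
  have hD : ∀ {e}, e ∈ Δ.face φ → e ∈ Δ.D := fun h => (Finset.mem_filter.1 h).1
  obtain ⟨a, ha⟩ : ∃ a, e.1 = a ∨ e.2 = a := ⟨e.1, Or.inl rfl⟩
  obtain ⟨b, hba, hb, jab⟩ := exists_other_end (hD he) ha
  obtain ⟨f, hf, hfe, hfb⟩ := exists_ne_mem_face hbr he hb
  obtain ⟨g, hg, hge, hga⟩ := exists_ne_mem_face hbr he ha
  obtain ⟨c, hcb, hc, jbc⟩ := exists_other_end (hD hf) hfb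
  obtain ⟨d, hda, hd, jad⟩ := exists_other_end (hD hg) hga
  obtain ⟨k, hk, hkf, hkc⟩ := exists_ne_mem_face hbr hf hc
  have hca : c ≠ a := by
    rintro rfl
    exact hfe (eq_of_common_ends (hD hf) (hD he) hba hfb hc hb ha)
  have hcd : c ≠ d := by
    rintro rfl
    exact htri a b c jab jbc jad
  have n1 : f ≠ g := by
    rintro rfl
    exact hfe (eq_of_common_ends (hD hf) (hD he) hba hfb hga hb ha)
  have only : ∀ {e : V × V} {u v w : V}, e ∈ Δ.D → u ≠ v → (e.1 = u ∨ e.2 = u) →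
      (e.1 = v ∨ e.2 = v) → (e.1 = w ∨ e.2 = w) → w = u ∨ w = v := by
    rintro e u v w - huv h1 h2 h3
    rcases h1 with rfl | rfl <;> rcases h2 with rfl | rfl <;> rcases h3 with rfl | rfl <;>
      simp at huv ⊢
  have n2 : k ≠ e := by
    rintro rfl
    rcases only (hD hk) hba hb ha hkc with h | h
    · exact hcb h
    · exact hca h
  have n3 : k ≠ g := by
    rintro rfl
    rcases only (hD hk) hda hd hga hkc with h | h
    · exact hcd h
    · exact hca h
  have hsub : ({e, f, g, k} : Finset (V × V)) ⊆ Δ.face φ := by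
    intro x hx
    simp only [Finset.mem_insert, Finset.mem_singleton] at hx
    rcases hx with rfl | rfl | rfl | rfl <;> assumption
  refine le_trans ?_ (Finset.card_le_card hsub)
  rw [Finset.card_insert_of_notMem, Finset.card_insert_of_notMem, Finset.card_insert_of_notMem,
    Finset.card_singleton]
  · simpa using n3.symm
  · simp [n1, hkf.symm]
  · simp [hfe.symm, hge.symm, n2.symm]

lemma cnt_single_apply {e : V × V} (he : e ∈ Δ.D) (z : Δ.cyc) :
    Δ.cnt (· = e) z = z.1 ⟨e, he⟩ := by
  rw [cnt_apply, Finset.sum_eq_single ⟨e, he⟩]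
  · simp
  · intro b _ hb
    have : b.1 ≠ e := fun h => hb (Subtype.ext h)
    simp [this]
  · simp

/-- Euler's formula for bridgeless triangle-free drawings, as an inequality that keeps track of
the length of the boundary of the face with vanishing parity functional. -/
lemma euler_inequality [Fintype V]
    (htri : ∀ a b c, Δ.Joined a b → Δ.Joined b c → Δ.Joined a c → False)
    (hbr : ∀ e ∈ Δ.D, Δ.cnt (· = e) ≠ 0) (S : Finset V) (hS : S.Nonempty)
    (hD : ∀ e ∈ Δ.D, e.1 ∈ S ∧ e.2 ∈ S) :
    2 * Δ.D.card + 4 + (Δ.face 0).card ≤ 4 * S.card := by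
  classical
  let Φ := (Δ.D.image Δ.ab ∪ Δ.D.image Δ.be).erase 0
  have h1 : 4 * Φ.card + (Δ.face 0).card ≤ 2 * Δ.D.card := by
    have h0 : (0 : Module.Dual (ZMod 2) Δ.cyc) ∉ Φ := Finset.notMem_erase _ _
    have h4 : 4 * Φ.card ≤ ∑ φ ∈ Φ, (Δ.face φ).card := by
      rw [mul_comm, ← smul_eq_mul]
      refine Finset.card_nsmul_le_sum _ _ _ fun φ hφ => ?_
      have hφ := Finset.mem_of_mem_erase hφ
      rw [Finset.mem_union, Finset.mem_image, Finset.mem_image] at hφ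
      rcases hφ with ⟨e, he, rfl⟩ | ⟨e, he, rfl⟩
      · exact four_le_card_face htri hbr (Finset.mem_filter.2 ⟨he, Or.inl rfl⟩)
      · exact four_le_card_face htri hbr (Finset.mem_filter.2 ⟨he, Or.inr rfl⟩)
    have h5 : ∑ φ ∈ insert 0 Φ, (Δ.face φ).card ≤ 2 * Δ.D.card := by
      simp only [face, Finset.card_filter]
      rw [Finset.sum_comm, mul_comm, ← smul_eq_mul]
      refine Finset.sum_le_card_nsmul _ _ _ fun e _ => ?_
      rw [← Finset.card_filter]
      refine (Finset.card_le_card (t := {Δ.ab e, Δ.be e}) ?_).trans Finset.card_le_two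
      intro φ hφ
      rcases (Finset.mem_filter.1 hφ).2 with h | h <;> simp [h]
    rw [Finset.sum_insert h0] at h5
    omega
  have h2 : Module.finrank (ZMod 2) Δ.cyc ≤ Φ.card := by
    let f : Δ.cyc →ₗ[ZMod 2] (Φ → ZMod 2) := LinearMap.pi fun φ => φ.1
    have hf : Function.Injective f := by
      rw [← LinearMap.ker_eq_bot, LinearMap.ker_eq_bot']
      intro z hz
      have key : ∀ φ ∈ Δ.D.image Δ.ab ∪ Δ.D.image Δ.be, φ z = 0 := by
        intro φ hφ
        by_cases h : φ = 0
        · simp [h]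
        · exact congr_fun hz ⟨φ, Finset.mem_erase.2 ⟨h, hφ⟩⟩
      ext ⟨e, he⟩
      have k1 := key (Δ.ab e) (Finset.mem_union_left _ (Finset.mem_image_of_mem _ he))
      have k2 := key (Δ.be e) (Finset.mem_union_right _ (Finset.mem_image_of_mem _ he))
      rw [be, LinearMap.add_apply, k1, zero_add, cnt_single_apply he] at k2
      exact k2
    have := LinearMap.finrank_le_finrank_of_injective hf
    rwa [Module.finrank_fintype_fun_eq_card, Fintype.card_coe] at this
  have h3 := card_le_finrank_cyc S hS hD
  omega

/-- An independent set of vertices on the face with functional `φ`, and edges avoiding it. -/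
lemma card_face_ge [Fintype V] (hbr : ∀ e ∈ Δ.D, Δ.cnt (· = e) ≠ 0)
    (φ : Module.Dual (ZMod 2) Δ.cyc) (T : Finset V)
    (hT : ∀ t ∈ T, ∃ e ∈ Δ.face φ, e.1 = t ∨ e.2 = t)
    (hind : ∀ e ∈ Δ.D, ¬ (e.1 ∈ T ∧ e.2 ∈ T)) (R : Finset (V × V)) (hR : R ⊆ Δ.face φ)
    (hRT : ∀ e ∈ R, e.1 ∉ T ∧ e.2 ∉ T) : 2 * T.card + R.card ≤ (Δ.face φ).card := by
  classical
  have h1 : 2 * T.card ≤ ((Δ.face φ) \ R).card := by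
    have h2 : ∀ t ∈ T, 2 ≤ (((Δ.face φ) \ R).filter fun e => e.1 = t ∨ e.2 = t).card := by
      intro t ht
      obtain ⟨e, he, het⟩ := hT t ht
      obtain ⟨f, hf, hfe, hft⟩ := exists_ne_mem_face hbr he het
      have hnR : ∀ e : V × V, (e.1 = t ∨ e.2 = t) → e ∉ R := by
        rintro e h hR
        have := hRT e hR
        rcases h with rfl | rfl
        · exact this.1 ht
        · exact this.2 ht
      rw [← Finset.card_pair hfe.symm]
      refine Finset.card_le_card fun x hx => ?_
      rw [Finset.mem_insert, Finset.mem_singleton] at hx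
      rw [Finset.mem_filter, Finset.mem_sdiff]
      rcases hx with rfl | rfl
      · exact ⟨⟨he, hnR _ het⟩, het⟩
      · exact ⟨⟨hf, hnR _ hft⟩, hft⟩
    have h3 := Finset.card_nsmul_le_sum _ _ _ h2
    rw [smul_eq_mul, mul_comm] at h3
    refine h3.trans ?_
    rw [← Finset.card_biUnion]
    · refine Finset.card_le_card fun x hx => ?_
      obtain ⟨t, -, h⟩ := Finset.mem_biUnion.1 hx
      exact (Finset.mem_filter.1 h).1
    · intro t ht t' ht' hne
      rw [Function.onFun, Finset.disjoint_left]
      intro e he he'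
      obtain ⟨heF, het⟩ := Finset.mem_filter.1 he
      obtain ⟨-, het'⟩ := Finset.mem_filter.1 he'
      have := hind e (Finset.mem_filter.1 (Finset.mem_sdiff.1 heF).1).1
      rcases het with rfl | rfl <;> rcases het' with rfl | rfl
      · exact hne rfl
      · exact this ⟨ht, ht'⟩
      · exact this ⟨ht', ht⟩
      · exact hne rfl
  have := Finset.card_sdiff_add_card_eq_card hR
  omega

variable (Δ)

/-- The edge `e` meets the upward vertical ray from `q`. -/
def Over (e : V × V) (q : ℝ × ℝ) : Prop :=
  Δ.X e.1 ≤ q.1 ∧ q.1 < Δ.X e.2 ∧ q.2 < Δ.ht e q.1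

/-- Parity functional of a point of the plane. -/
noncomputable def nf (q : ℝ × ℝ) : Module.Dual (ZMod 2) Δ.cyc := Δ.cnt fun e => Δ.Over e q

/-- The point `q` lies off the edge `e`. -/
def Off (e : V × V) (q : ℝ × ℝ) : Prop :=
  Δ.X e.1 ≤ q.1 → q.1 ≤ Δ.X e.2 → q.2 ≠ Δ.ht e q.1

variable {Δ}

lemma eventually_lt_ht {e : V × V} {p : ℝ × ℝ} (h : p.2 < Δ.ht e p.1) :
    ∀ᶠ q in 𝓝 p, q.2 < Δ.ht e q.1 :=
  continuous_snd.continuousAt.eventually_lt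
    ((Δ.continuous_ht e).comp continuous_fst).continuousAt h

lemma eventually_ht_lt {e : V × V} {p : ℝ × ℝ} (h : Δ.ht e p.1 < p.2) :
    ∀ᶠ q in 𝓝 p, Δ.ht e q.1 < q.2 :=
  ((Δ.continuous_ht e).comp continuous_fst).continuousAt.eventually_lt
    continuous_snd.continuousAt h

lemma eventually_fst_lt {p : ℝ × ℝ} {c : ℝ} (h : p.1 < c) : ∀ᶠ q in 𝓝 p, q.1 < c :=
  continuous_fst.continuousAt.eventually_lt continuousAt_const h

lemma eventually_lt_fst {p : ℝ × ℝ} {c : ℝ} (h : c < p.1) : ∀ᶠ q in 𝓝 p, c < q.1 :=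
  continuousAt_const.eventually_lt continuous_fst.continuousAt h

lemma eventually_over_iff {e : V × V} {p : ℝ × ℝ} (h1 : p.1 ≠ Δ.X e.1)
    (h2 : p.1 ≠ Δ.X e.2) (h3 : Δ.X e.1 < p.1 → p.1 < Δ.X e.2 → p.2 ≠ Δ.ht e p.1) :
    ∀ᶠ q in 𝓝 p, (Δ.Over e q ↔ Δ.X e.1 < p.1 ∧ p.1 < Δ.X e.2 ∧ p.2 < Δ.ht e p.1) := by
  rcases lt_or_gt_of_ne h1 with h | h
  · filter_upwards [eventually_fst_lt h] with q hq
    simp [Over, not_lt.2 h.le, not_le.2 hq]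
  rcases lt_or_gt_of_ne h2 with h' | h'
  · rcases lt_or_gt_of_ne (h3 h h') with h'' | h''
    · filter_upwards [eventually_lt_fst h, eventually_fst_lt h', eventually_lt_ht h'']
        with q q1 q2 q3
      simp [Over, h, h', h'', q1.le, q2, q3]
    · filter_upwards [eventually_lt_fst h, eventually_fst_lt h', eventually_ht_lt h'']
        with q q1 q2 q3
      simp [Over, h, h', not_lt.2 h''.le, q1.le, q2, not_lt.2 q3.le]
  · filter_upwards [eventually_lt_fst h'] with q hq
    simp [Over, not_lt.2 h'.le, not_lt.2 hq.le]

lemma eventually_nf_eq [Fintype V] {p : ℝ × ℝ} (hp : ∀ e ∈ Δ.D, Δ.Off e p) :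
    ∀ᶠ q in 𝓝 p, Δ.nf q = Δ.nf p := by
  suffices h : ∃ C, ∀ᶠ q in 𝓝 p, Δ.nf q = C by
    obtain ⟨C, hC⟩ := h
    filter_upwards [hC] with q hq
    rw [hq, hC.self_of_nhds]
  by_cases hv : ∃ v, Δ.X v = p.1
  · obtain ⟨v, hv⟩ := hv
    have hne : ∀ {u}, u ≠ v → p.1 ≠ Δ.X u := fun h h' => h (Δ.inj (h'.symm.trans hv.symm))
    have hmain : ∀ᶠ q in 𝓝 p, ∀ e ∈ Δ.D, (Δ.Over e q ↔
        (Δ.X e.1 < p.1 ∧ p.1 < Δ.X e.2 ∧ p.2 < Δ.ht e p.1) ∨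
        (p.2 < Δ.Y v ∧ (e.1 = v ∧ p.1 ≤ q.1 ∨ e.2 = v ∧ q.1 < p.1))) := by
      rw [eventually_all_finset]
      intro e he
      have hl := Δ.lt e he
      have ho := hp e he
      by_cases h1 : e.1 = v
      · have h2 : e.2 ≠ v := fun h => by rw [h1, h] at hl; exact lt_irrefl _ hl
        have hx : Δ.X e.1 = p.1 := by rw [h1, hv]
        have hy : Δ.ht e p.1 = Δ.Y v := by rw [← hx, ht_left, h1]
        rw [Off, hy] at ho
        rcases lt_or_gt_of_ne (ho hx.le (hx ▸ hl.le)) with h | h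
        · rw [← hy] at h
          filter_upwards [eventually_fst_lt (hx ▸ hl), eventually_lt_ht h] with q q1 q2
          simp [Over, hv, q1, q2, h1, h2, ← hy, h]
        · have h' := h
          rw [← hy] at h'
          filter_upwards [eventually_ht_lt h'] with q q2
          simp [Over, hx, not_lt.2 q2.le, not_lt.2 h.le]
      · by_cases h2 : e.2 = v
        · have hx : Δ.X e.2 = p.1 := by rw [h2, hv]
          have hy : Δ.ht e p.1 = Δ.Y v := by rw [← hx, Δ.ht_right he, h2]
          rw [Off, hy] at ho
          rcases lt_or_gt_of_ne (ho (hx ▸ hl.le) hx.ge) with h | h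
          · rw [← hy] at h
            filter_upwards [eventually_lt_fst (hx ▸ hl), eventually_lt_ht h] with q q1 q2
            simp [Over, hv, q1.le, q2, h1, h2, ← hy, h]
          · have h' := h
            rw [← hy] at h'
            filter_upwards [eventually_ht_lt h'] with q q2
            simp [Over, hx, not_lt.2 q2.le, not_lt.2 h.le]
        · filter_upwards [eventually_over_iff (Δ := Δ) (e := e) (hne h1) (hne h2)
            (fun a b => ho a.le b.le)] with q hq
          rw [hq]
          simp [h1, h2]
    refine ⟨(Δ.cnt fun e => Δ.X e.1 < p.1 ∧ p.1 < Δ.X e.2 ∧ p.2 < Δ.ht e p.1) +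
      Δ.cnt fun e => p.2 < Δ.Y v ∧ e.1 = v, ?_⟩
    filter_upwards [hmain] with q hq
    rcases le_or_gt p.1 q.1 with h | h
    · refine cnt_add (fun e he => ?_) ?_
      · rw [hq e he]
        simp [h, not_lt.2 h]
      · rintro e he ⟨h1, -, -⟩ ⟨-, h2⟩
        rw [h2, hv] at h1
        exact lt_irrefl _ h1
    · rw [cnt_eq_of_cut (p := fun e => p.2 < Δ.Y v ∧ e.1 = v)
        (q := fun e => p.2 < Δ.Y v ∧ e.2 = v) (fun u => p.2 < Δ.Y v ∧ u = v)
        (fun e he => Iff.rfl)]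
      refine cnt_add (fun e he => ?_) ?_
      · rw [hq e he]
        simp [h, not_le.2 h]
      · rintro e he ⟨-, h1, -⟩ ⟨-, h2⟩
        rw [h2, hv] at h1
        exact lt_irrefl _ h1
  · push Not at hv
    refine ⟨Δ.cnt fun e => Δ.X e.1 < p.1 ∧ p.1 < Δ.X e.2 ∧ p.2 < Δ.ht e p.1, ?_⟩
    have : ∀ᶠ q in 𝓝 p, ∀ e ∈ Δ.D, (Δ.Over e q ↔
        Δ.X e.1 < p.1 ∧ p.1 < Δ.X e.2 ∧ p.2 < Δ.ht e p.1) := by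
      rw [eventually_all_finset]
      exact fun e he => eventually_over_iff (hv _).symm (hv _).symm
        fun a b => hp e he a.le b.le
    filter_upwards [this] with q hq
    exact cnt_congr hq

lemma ht_mem_Icc {e : V × V} (he : e ∈ Δ.D) {x M : ℝ} (h1 : Δ.X e.1 ≤ x) (h2 : x ≤ Δ.X e.2)
    (hM : ∀ v, |Δ.Y v| ≤ M) : |Δ.ht e x| ≤ M := by
  have a1 := abs_le.1 (hM e.1)
  have a2 := abs_le.1 (hM e.2)
  rw [abs_le]
  rcases le_total 0 (Δ.slope e) with h | h
  · constructor
    · rw [ht_eq]; nlinarith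
    · rw [Δ.ht_eq' he]; nlinarith
  · constructor
    · rw [Δ.ht_eq' he]; nlinarith
    · rw [ht_eq]; nlinarith

/-- The parity functional vanishes on an unbounded connected set avoiding the drawing. -/
lemma nf_eq_zero [Fintype V] {F : Set (ℝ × ℝ)} (hF : IsPreconnected F)
    (hunb : ¬ Bornology.IsBounded F) (hoff : ∀ q ∈ F, ∀ e ∈ Δ.D, Δ.Off e q) :
    ∀ q ∈ F, Δ.nf q = 0 := by
  classical
  obtain ⟨M, hX, hY⟩ : ∃ M, (∀ v, |Δ.X v| ≤ M) ∧ ∀ v, |Δ.Y v| ≤ M := by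
    refine ⟨∑ v, |Δ.X v| + ∑ v, |Δ.Y v|, fun v => ?_, fun v => ?_⟩
    · have h1 := Finset.single_le_sum (f := fun v => |Δ.X v|) (fun i _ => abs_nonneg _)
        (Finset.mem_univ v)
      have h2 : 0 ≤ ∑ v, |Δ.Y v| := Finset.sum_nonneg fun _ _ => abs_nonneg _
      linarith
    · have h1 := Finset.single_le_sum (f := fun v => |Δ.Y v|) (fun i _ => abs_nonneg _)
        (Finset.mem_univ v)
      have h2 : 0 ≤ ∑ v, |Δ.X v| := Finset.sum_nonneg fun _ _ => abs_nonneg _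
      linarith
  obtain ⟨p, hp, hp0⟩ : ∃ p ∈ F, Δ.nf p = 0 := by
    obtain ⟨p, hp, hpM⟩ : ∃ p ∈ F, M < |p.1| ∨ M < |p.2| := by
      by_contra! hcon
      refine hunb ((Metric.isBounded_Icc ((-M, -M) : ℝ × ℝ) (M, M)).subset fun q hq => ?_)
      obtain ⟨h1, h2⟩ := hcon q hq
      rw [abs_le] at h1 h2
      exact ⟨⟨h1.1, h2.1⟩, ⟨h1.2, h2.2⟩⟩
    refine ⟨p, hp, ?_⟩
    rcases hpM with h | h
    · refine cnt_eq_zero fun e he ⟨h1, h2, _⟩ => ?_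
      have a1 := abs_le.1 (hX e.1)
      have a2 := abs_le.1 (hX e.2)
      rcases lt_abs.1 h with h | h <;> linarith
    · rcases lt_abs.1 h with h | h
      · refine cnt_eq_zero fun e he ⟨h1, h2, h3⟩ => ?_
        have := abs_le.1 (ht_mem_Icc he h1 h2.le hY)
        linarith
      · rw [nf, ← cnt_eq_zero (Δ := Δ) (p := fun _ => False) (by simp)]
        refine cnt_eq_of_cut (fun v => Δ.X v ≤ p.1) fun e he => ?_
        have hl := Δ.lt e he
        simp only [Over]
        constructor
        · intro h'
          constructor
          · intro h1
            by_contra h2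
            have := abs_le.1 (ht_mem_Icc he h1 (not_le.1 h2).le hY)
            exact h'.1 ⟨h1, not_le.1 h2, by linarith⟩
          · intro h2; linarith
        · intro h'
          simp only [iff_false]
          rintro ⟨h1, h2, -⟩
          exact absurd (h'.1 h1) (not_le.2 h2)
  intro q hq
  have hc : ContinuousOn (fun q => decide (Δ.nf q = 0)) F := by
    intro r hr
    refine ContinuousAt.continuousWithinAt ?_
    refine (continuousAt_const (y := decide (Δ.nf r = 0))).congr ?_
    filter_upwards [eventually_nf_eq (hoff r hr)] with s hs
    rw [hs]
  have := hF.constant hc hq hp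
  simpa [hp0] using this

lemma exists_mem_face_of_top_eq_zero [Fintype V] {v : V} (htop : Δ.top v = 0) {e₀ : V × V}
    (he₀ : e₀ ∈ Δ.D) (hv : e₀.1 = v ∨ e₀.2 = v) :
    ∃ e ∈ Δ.face 0, e.1 = v ∨ e.2 = v := by
  classical
  rcases hv with hv | hv
  · obtain ⟨e, he, hmax⟩ := Finset.exists_max_image (Δ.D.filter (·.1 = v)) Δ.slope
      ⟨e₀, Finset.mem_filter.2 ⟨he₀, hv⟩⟩
    obtain ⟨heD, rfl⟩ := Finset.mem_filter.1 he
    refine ⟨e, Finset.mem_filter.2 ⟨heD, Or.inl ?_⟩, Or.inl rfl⟩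
    rw [Δ.ab_at_left heD, htop, Finset.filter_eq_empty_iff.2, Finset.sum_empty, add_zero]
    exact fun f hf => not_lt.2 (hmax f hf)
  · obtain ⟨e, he, hmax⟩ := Finset.exists_max_image (Δ.D.filter (·.2 = v)) (fun e => -Δ.slope e)
      ⟨e₀, Finset.mem_filter.2 ⟨he₀, hv⟩⟩
    obtain ⟨heD, rfl⟩ := Finset.mem_filter.1 he
    refine ⟨e, Finset.mem_filter.2 ⟨heD, Or.inl ?_⟩, Or.inr rfl⟩
    rw [Δ.ab_at_right heD, htop, Finset.filter_eq_empty_iff.2, Finset.sum_empty, add_zero]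
    exact fun f hf => not_lt.2 (hmax f hf)

lemma eventually_over_iff_of_vertex {v : V} {e₀ : V × V} (he₀ : e₀ ∈ Δ.D)
    (hv : e₀.1 = v ∨ e₀.2 = v) : ∀ᶠ q in 𝓝 ((Δ.X v, Δ.Y v) : ℝ × ℝ), ∀ e ∈ Δ.D, (Δ.Over e q ↔
      (Δ.X e.1 < Δ.X v ∧ Δ.X v < Δ.X e.2 ∧ Δ.Y v < Δ.ht e (Δ.X v)) ∨
      (Δ.X v ≤ q.1 ∧ e.1 = v ∧ q.2 < Δ.ht e q.1) ∨
      (q.1 < Δ.X v ∧ e.2 = v ∧ q.2 < Δ.ht e q.1)) := by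
  rw [eventually_all_finset]
  intro e he
  have hl := Δ.lt e he
  by_cases h1 : e.1 = v
  · have h2 : e.2 ≠ v := fun h => by rw [h1, h] at hl; exact lt_irrefl _ hl
    rw [h1] at hl
    filter_upwards [eventually_fst_lt (p := (Δ.X v, Δ.Y v)) hl] with q hq
    simp [Over, h1, h2, hq]
  by_cases h2 : e.2 = v
  · rw [h2] at hl
    filter_upwards [eventually_lt_fst (p := (Δ.X v, Δ.Y v)) hl] with q hq
    simp [Over, h1, h2, hq.le]
  · have hne : ∀ {u}, u ≠ v → (Δ.X v, Δ.Y v).1 ≠ Δ.X u := fun h h' => h (Δ.inj h'.symm)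
    filter_upwards [eventually_over_iff (Δ := Δ) (e := e) (hne h1) (hne h2) (by
      intro a b h
      have hne0 : e ≠ e₀ := by rintro rfl; tauto
      have hl0 := Δ.lt e₀ he₀
      simp only at a b h
      have hy : Δ.ht e₀ (Δ.X v) = Δ.Y v := by
        rcases hv with rfl | rfl
        · rw [ht_left]
        · rw [Δ.ht_right he₀]
      have := (Δ.meet e he e₀ he₀ hne0 (Δ.X v) a.le b.le
        (by rcases hv with rfl | rfl <;> linarith) (by rcases hv with rfl | rfl <;> linarith)
        (show Δ.ht e (Δ.X v) = Δ.ht e₀ (Δ.X v) by rw [hy, h])).1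
      rcases this with h | h <;> linarith)] with q hq
    rw [hq]
    simp [h1, h2]

lemma exists_mem_face_of_mem_closure [Fintype V] {F : Set (ℝ × ℝ)} (hF : ∀ q ∈ F, Δ.nf q = 0)
    {v : V} (hvF : (Δ.X v, Δ.Y v) ∈ closure F) {e₀ : V × V}
    (he₀ : e₀ ∈ Δ.D) (hv : e₀.1 = v ∨ e₀.2 = v) :
    ∃ e ∈ Δ.face 0, e.1 = v ∨ e.2 = v := by
  classical
  obtain ⟨q, hqF, hq⟩ := ((mem_closure_iff_frequently.1 hvF).and_eventually
    (eventually_over_iff_of_vertex he₀ hv)).exists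
  have h0 := hF q hqF
  rcases le_or_gt (Δ.X v) q.1 with h | h
  · let W := Δ.D.filter fun e => e.1 = v ∧ q.2 < Δ.ht e q.1
    have hW : Δ.nf q = Δ.top v + Δ.cnt (· ∈ W) := by
      refine cnt_add (fun e he => ?_) ?_
      · rw [hq e he]
        simp [h, not_lt.2 h, W, he]
      · rintro e he ⟨h1, -, -⟩ h2
        rw [(Finset.mem_filter.1 h2).2.1] at h1
        exact lt_irrefl _ h1
    rcases W.eq_empty_or_nonempty with hWe | hWn
    · refine exists_mem_face_of_top_eq_zero ?_ he₀ hv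
      rw [hWe, h0, cnt_eq_zero (by simp), add_zero] at hW
      exact hW.symm
    · obtain ⟨e, he, hmin⟩ := Finset.exists_min_image W Δ.slope hWn
      obtain ⟨heD, rfl, hqe⟩ := Finset.mem_filter.1 he
      refine ⟨e, Finset.mem_filter.2 ⟨heD, Or.inr ?_⟩, Or.inl rfl⟩
      rw [be, Δ.ab_at_left heD, ← h0, hW, add_assoc, sum_cnt_single _
        ((Finset.filter_subset _ _).trans (Finset.filter_subset _ _))]
      congr 1
      symm
      refine cnt_add (fun f hf => ?_) ?_
      · simp only [W, Finset.mem_filter, hf, true_and]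
        constructor
        · rintro ⟨f1, f2⟩
          rcases (hmin f (Finset.mem_filter.2 ⟨hf, f1, f2⟩)).lt_or_eq with hs | hs
          · exact Or.inl ⟨f1, hs⟩
          · exact Or.inr (Δ.slope_injOn_left heD hf f1 hs).symm
        · rintro (⟨f1, f2⟩ | rfl)
          · refine ⟨f1, hqe.trans_le ?_⟩
            rw [ht_eq, ht_eq, f1]
            nlinarith
          · exact ⟨rfl, hqe⟩
      · rintro f - h1 rfl
        exact lt_irrefl _ (Finset.mem_filter.1 h1).2
  · let W := Δ.D.filter fun e => e.2 = v ∧ q.2 < Δ.ht e q.1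
    have hW : Δ.nf q = Δ.top v + Δ.cnt (· ∈ W) := by
      refine cnt_add (fun e he => ?_) ?_
      · rw [hq e he]
        simp [h, not_le.2 h, W, he]
      · rintro e he ⟨-, h1, -⟩ h2
        rw [(Finset.mem_filter.1 h2).2.1] at h1
        exact lt_irrefl _ h1
    rcases W.eq_empty_or_nonempty with hWe | hWn
    · refine exists_mem_face_of_top_eq_zero ?_ he₀ hv
      rw [hWe, h0, cnt_eq_zero (by simp), add_zero] at hW
      exact hW.symm
    · obtain ⟨e, he, hmin⟩ := Finset.exists_min_image W (fun e => -Δ.slope e) hWn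
      obtain ⟨heD, rfl, hqe⟩ := Finset.mem_filter.1 he
      refine ⟨e, Finset.mem_filter.2 ⟨heD, Or.inr ?_⟩, Or.inr rfl⟩
      rw [be, Δ.ab_at_right heD, ← h0, hW, add_assoc, sum_cnt_single _
        ((Finset.filter_subset _ _).trans (Finset.filter_subset _ _))]
      congr 1
      symm
      refine cnt_add (fun f hf => ?_) ?_
      · simp only [W, Finset.mem_filter, hf, true_and]
        constructor
        · rintro ⟨f1, f2⟩
          rcases (hmin f (Finset.mem_filter.2 ⟨hf, f1, f2⟩)).lt_or_eq with hs | hs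
          · exact Or.inl ⟨f1, hs⟩
          · exact Or.inr (Δ.slope_injOn_right heD hf f1 (neg_inj.1 hs)).symm
        · rintro (⟨f1, f2⟩ | rfl)
          · refine ⟨f1, hqe.trans_le ?_⟩
            rw [Δ.ht_eq' heD, Δ.ht_eq' hf, f1]
            nlinarith
          · exact ⟨rfl, hqe⟩
      · rintro f - h1 rfl
        exact lt_irrefl _ (Finset.mem_filter.1 h1).2

lemma mem_face_of_subset_closure [Fintype V] {F : Set (ℝ × ℝ)} (hF : ∀ q ∈ F, Δ.nf q = 0)
    {e : V × V} (he : e ∈ Δ.D)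
    (heF : ∀ x, Δ.X e.1 ≤ x → x ≤ Δ.X e.2 → (x, Δ.ht e x) ∈ closure F) : e ∈ Δ.face 0 := by
  classical
  have hl := Δ.lt e he
  obtain ⟨x, hx1, hx2, hx⟩ : ∃ x, Δ.X e.1 < x ∧ x < Δ.X e.2 ∧
      ∀ v, Δ.X e.1 < Δ.X v → x < Δ.X v := by
    have h : ∀ᶠ x in 𝓝[>] (Δ.X e.1), ∀ v, Δ.X e.1 < Δ.X v → x < Δ.X v := by
      rw [eventually_all]
      intro v
      by_cases hv : Δ.X e.1 < Δ.X v
      · filter_upwards [nhdsWithin_le_nhds (eventually_lt_nhds hv)] with x hx _ using hx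
      · simp [hv]
    obtain ⟨x, hx, hx'⟩ := (h.and self_mem_nhdsWithin).exists
    exact ⟨x, hx', hx _ hl, hx⟩
  have hloc : ∀ᶠ q in 𝓝 ((x, Δ.ht e x) : ℝ × ℝ), ∀ f ∈ Δ.D, (Δ.Over f q ↔
      (Δ.X f.1 ≤ Δ.X e.1 ∧ Δ.X e.1 < Δ.X f.2 ∧ Δ.Above f e) ∨ (q.2 < Δ.ht e q.1 ∧ f = e)) := by
    rw [eventually_all_finset]
    intro f hf
    have hlf := Δ.lt f hf
    by_cases hfe : f = e
    · subst hfe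
      filter_upwards [eventually_fst_lt (p := (x, Δ.ht f x)) hx2,
        eventually_lt_fst (p := (x, Δ.ht f x)) hx1] with q q1 q2
      simp [Over, q1, q2.le, Above]
    · have i1 : Δ.X f.1 < x ↔ Δ.X f.1 ≤ Δ.X e.1 :=
        ⟨fun h => not_lt.1 fun h' => absurd (hx _ h') h.not_gt, fun h => h.trans_lt hx1⟩
      have i2 : x < Δ.X f.2 ↔ Δ.X e.1 < Δ.X f.2 := ⟨fun h => hx1.trans h, hx _⟩
      have n : ∀ v, x ≠ Δ.X v := by
        rintro v rfl
        exact lt_irrefl _ (hx v hx1)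
      filter_upwards [eventually_over_iff (Δ := Δ) (e := f) (p := (x, Δ.ht e x)) (n _) (n _) (by
        intro a b h
        have := (Δ.meet e he f hf (Ne.symm hfe) x hx1.le hx2.le a.le b.le h).1
        rcases this with h | h <;> exact n _ h)] with q hq
      rw [hq]
      simp only [hfe, and_false, or_false, i1, i2]
      refine and_congr_right fun a => and_congr_right fun b => ?_
      exact (Δ.above_iff he hf hx1.le hx2.le (i1.2 a).le (i2.2 b).le b (a.trans_lt hl)
        (Or.inl ⟨n _, n _⟩)).symm
  obtain ⟨q, hqF, hq⟩ := ((mem_closure_iff_frequently.1 (heF x hx1.le hx2.le)).and_eventually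
    hloc).exists
  have h0 := hF q hqF
  refine Finset.mem_filter.2 ⟨he, ?_⟩
  by_cases h : q.2 < Δ.ht e q.1
  · right
    rw [← h0]
    symm
    refine cnt_add (fun f hf => ?_) ?_
    · rw [hq f hf]; simp [h]
    · rintro f - ⟨-, -, h1⟩ rfl
      simp [Above] at h1
  · left
    rw [← h0]
    refine cnt_congr fun f hf => ?_
    rw [hq f hf]
    simp [h]

/-- The drawing with edge set reduced to `D`. -/
def restrict (Δ : Drawing V) (D : Finset (V × V)) (h : D ⊆ Δ.D) : Drawing V where
  X := Δ.X
  Y := Δ.Y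
  D := D
  inj := Δ.inj
  lt e he := Δ.lt e (h he)
  meet e he e' he' := Δ.meet e (h he) e' (h he')

lemma joined_of_restrict {D : Finset (V × V)} {h : D ⊆ Δ.D} {u v : V}
    (huv : (Δ.restrict D h).Joined u v) : Δ.Joined u v :=
  huv.imp (fun h' => h h') fun h' => h h'

/-- Vertex sets `T` and `P` of a triangle-free drawing with short lists, relative to an unbounded
region `F` of the complement of the drawing. -/
structure ShortLists (Δ : Drawing V) (F : Set (ℝ × ℝ)) (T P : Finset V) : Prop where
  preconnected : IsPreconnected F
  unbounded : ¬ Bornology.IsBounded F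
  off : ∀ q ∈ F, ∀ e ∈ Δ.D, Δ.Off e q
  triangleFree : ∀ a b c, Δ.Joined a b → Δ.Joined b c → Δ.Joined a c → False
  disjoint : Disjoint T P
  indep : ∀ e ∈ Δ.D, ¬ (e.1 ∈ T ∧ e.2 ∈ T)
  mem_closure : ∀ t ∈ T, (Δ.X t, Δ.Y t) ∈ closure F
  card_le : P.card ≤ 2
  joined : ∀ u ∈ P, ∀ v ∈ P, u ≠ v → Δ.Joined u v
  edge_subset : ∀ e ∈ Δ.D, e.1 ∈ P → e.2 ∈ P → ∀ x, Δ.X e.1 ≤ x → x ≤ Δ.X e.2 →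
    (x, Δ.ht e x) ∈ closure F

namespace ShortLists

variable [Fintype V] [DecidableEq V] {F : Set (ℝ × ℝ)} {T P : Finset V}

lemma card_le_of_bridgeless (h : Δ.ShortLists F T P) {S : Finset V} (hS : S.Nonempty)
    {D : Finset (V × V)} (hD : D ⊆ Δ.D) (hDS : ∀ e ∈ D, e.1 ∈ S ∧ e.2 ∈ S)
    (hinc : ∀ v ∈ S, ∃ e ∈ D, e.1 = v ∨ e.2 = v)
    (hbr : ∀ e ∈ D, (Δ.restrict D hD).cnt (· = e) ≠ 0) :
    D.card + (S ∩ T).card + 2 ≤ 2 * S.card ∧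
      ∀ e ∈ D, e.1 ∈ P → e.2 ∈ P → D.card + (S ∩ T).card + 3 ≤ 2 * S.card := by
  set Δ' := Δ.restrict D hD with hΔ'
  have hF : ∀ q ∈ F, Δ'.nf q = 0 :=
    nf_eq_zero h.preconnected h.unbounded fun q hq e he => h.off q hq e (hD he)
  have h1 : 2 * D.card + 4 + (Δ'.face 0).card ≤ 4 * S.card :=
    euler_inequality (Δ := Δ') (fun a b c h1 h2 h3 => h.triangleFree a b c (joined_of_restrict h1)
      (joined_of_restrict h2) (joined_of_restrict h3)) hbr S hS hDS
  have hT : ∀ t ∈ S ∩ T, ∃ e ∈ Δ'.face 0, e.1 = t ∨ e.2 = t := fun t ht => by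
    obtain ⟨e, he, het⟩ := hinc t (Finset.mem_inter.1 ht).1
    exact exists_mem_face_of_mem_closure (Δ := Δ') hF (h.mem_closure t (Finset.mem_inter.1 ht).2)
      he het
  have hind : ∀ e ∈ Δ'.D, ¬ (e.1 ∈ S ∩ T ∧ e.2 ∈ S ∩ T) := fun e he h' =>
    h.indep e (hD he) ⟨(Finset.mem_inter.1 h'.1).2, (Finset.mem_inter.1 h'.2).2⟩
  constructor
  · have := card_face_ge (Δ := Δ') hbr 0 (S ∩ T) hT hind ∅ (by simp) (by simp)
    omega
  · intro e he he1 he2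
    have hn : ∀ v ∈ P, v ∉ S ∩ T := fun v hv hv' =>
      Finset.disjoint_left.1 h.disjoint (Finset.mem_inter.1 hv').2 hv
    have hef : e ∈ Δ'.face 0 := mem_face_of_subset_closure (Δ := Δ') hF he
      (h.edge_subset e (hD he) he1 he2)
    have := card_face_ge (Δ := Δ') hbr 0 (S ∩ T) hT hind {e} (by simpa using hef)
      (fun f hf => by
        rw [Finset.mem_singleton.1 hf]; exact ⟨hn _ he1, hn _ he2⟩)
    rw [Finset.card_singleton] at this
    omega

theorem card_le_two_mul (h : Δ.ShortLists F T P) (S : Finset V) :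
    ∀ D ⊆ Δ.D, (∀ e ∈ D, e.1 ∈ S ∧ e.2 ∈ S) →
      (∀ e ∈ Δ.D, e.1 ∈ S → e.2 ∈ S → e.1 ∈ P → e.2 ∈ P → e ∈ D) →
      (D.filter fun e => ¬ (e.1 ∈ P ∧ e.2 ∈ P)).card + (S ∩ T).card + 2 * (S ∩ P).card ≤
        2 * S.card ∧
      (S.Nonempty → S ∩ P = ∅ → D.card + (S ∩ T).card + 1 ≤ 2 * S.card) := by
  induction S using Finset.strongInduction with
  | H S ih =>
  intro D hD hDS hPD
  rcases S.eq_empty_or_nonempty with rfl | hS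
  · have : D = ∅ := Finset.eq_empty_of_forall_notMem fun e he => by simpa using hDS e he
    simp [this]
  by_cases hiso : ∃ v ∈ S, ∀ e ∈ D, e.1 ≠ v ∧ e.2 ≠ v
  · obtain ⟨v, hv, hvD⟩ := hiso
    obtain ⟨i1, i2⟩ := ih (S.erase v) (Finset.erase_ssubset hv) D hD
      (fun e he => ⟨Finset.mem_erase.2 ⟨(hvD e he).1, (hDS e he).1⟩,
        Finset.mem_erase.2 ⟨(hvD e he).2, (hDS e he).2⟩⟩)
      (fun e he h1 h2 => hPD e he (Finset.mem_of_mem_erase h1) (Finset.mem_of_mem_erase h2))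
    have hc := Finset.card_erase_add_one hv
    have hT : (S ∩ T).card = ((S.erase v) ∩ T).card + if v ∈ T then 1 else 0 := by
      rw [Finset.erase_inter]
      split_ifs with hvT
      · rw [Finset.card_erase_add_one (Finset.mem_inter.2 ⟨hv, hvT⟩)]
      · rw [Finset.erase_eq_of_notMem (fun h => hvT (Finset.mem_inter.1 h).2), add_zero]
    have hP : (S ∩ P).card = ((S.erase v) ∩ P).card + if v ∈ P then 1 else 0 := by
      rw [Finset.erase_inter]
      split_ifs with hvT
      · rw [Finset.card_erase_add_one (Finset.mem_inter.2 ⟨hv, hvT⟩)]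
      · rw [Finset.erase_eq_of_notMem (fun h => hvT (Finset.mem_inter.1 h).2), add_zero]
    have hTP : v ∈ T → v ∉ P := fun h1 h2 => Finset.disjoint_left.1 h.disjoint h1 h2
    constructor
    · by_cases hvT : v ∈ T
      · simp only [hvT, hTP hvT, if_true, if_false] at hT hP
        omega
      · by_cases hvP : v ∈ P <;> simp only [hvT, hvP, if_true, if_false] at hT hP <;> omega
    · intro _ hSP
      have hT1 : (S ∩ T).card ≤ ((S.erase v) ∩ T).card + 1 := by
        rw [hT]; split_ifs <;> omega
      rcases (S.erase v).eq_empty_or_nonempty with h0 | hne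
      · have : D = ∅ := Finset.eq_empty_of_forall_notMem fun e he => by
          have := Finset.mem_erase.2 ⟨(hvD e he).1, (hDS e he).1⟩
          rw [h0] at this
          simp at this
        rw [h0] at hT1 hc
        simp [this] at hT1 hc ⊢
        omega
      · have := i2 hne (by rw [Finset.erase_inter, hSP, Finset.erase_empty])
        omega
  push Not at hiso
  by_cases hbr : ∃ ε ∈ D, (Δ.restrict D hD).cnt (· = ε) = 0
  · obtain ⟨ε, hε, hε0⟩ := hbr
    obtain ⟨g, hg⟩ := exists_cut_of_cnt_eq_zero (Δ := Δ.restrict D hD) hε hε0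
    classical
    have hg' : ∀ e ∈ D, e ≠ ε → (g e.1 ↔ g e.2) := fun e he => (hg e he).2
    have hgε : ¬ (g ε.1 ↔ g ε.2) := fun h => (hg ε hε).1 h rfl
    have key : ∀ (p : V → Prop) [DecidablePred p], (∃ v ∈ S, ¬ p v) →
        ((D.filter fun e => p e.1 ∧ p e.2).filter fun e => ¬ (e.1 ∈ P ∧ e.2 ∈ P)).card +
            (S.filter p ∩ T).card + 2 * (S.filter p ∩ P).card ≤ 2 * (S.filter p).card ∧
          ((S.filter p).Nonempty → S.filter p ∩ P = ∅ →
            (D.filter fun e => p e.1 ∧ p e.2).card + (S.filter p ∩ T).card + 1 ≤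
              2 * (S.filter p).card) := by
      intro p _ hp
      refine ih (S.filter p) (Finset.filter_ssubset.2 hp) _
        ((Finset.filter_subset _ _).trans hD) (fun e he => ?_) fun e he h1 h2 h3 h4 => ?_
      · obtain ⟨he, h1, h2⟩ := Finset.mem_filter.1 he
        exact ⟨Finset.mem_filter.2 ⟨(hDS e he).1, h1⟩, Finset.mem_filter.2 ⟨(hDS e he).2, h2⟩⟩
      · obtain ⟨h1, h1'⟩ := Finset.mem_filter.1 h1
        obtain ⟨h2, h2'⟩ := Finset.mem_filter.1 h2
        exact Finset.mem_filter.2 ⟨hPD e he h1 h2 h3 h4, h1', h2'⟩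
    have hend : (∃ v ∈ S, g v) ∧ ∃ v ∈ S, ¬ g v := by
      by_cases h1 : g ε.1
      · exact ⟨⟨_, (hDS ε hε).1, h1⟩, _, (hDS ε hε).2, fun h2 => hgε (iff_of_true h1 h2)⟩
      · exact ⟨⟨_, (hDS ε hε).2, by by_contra h2; exact hgε (iff_of_false h1 h2)⟩,
          _, (hDS ε hε).1, h1⟩
    obtain ⟨a1, a2⟩ := key g hend.2
    obtain ⟨b1, b2⟩ := key (fun v => ¬ g v) (by simpa using hend.1)
    have hAne : (S.filter g).Nonempty := Finset.filter_nonempty_iff.2 hend.1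
    have hBne : (S.filter fun v => ¬ g v).Nonempty := Finset.filter_nonempty_iff.2 hend.2
    have hcard : ∀ Q : Finset V, (S ∩ Q).card =
        (S.filter g ∩ Q).card + ((S.filter fun v => ¬ g v) ∩ Q).card := fun Q => by
      rw [Finset.filter_inter, Finset.filter_inter,
        Finset.card_filter_add_card_filter_not]
    have hS' := Finset.card_filter_add_card_filter_not (s := S) g
    have hedges : D.erase ε = (D.filter fun e => g e.1 ∧ g e.2) ∪
        D.filter fun e => ¬ g e.1 ∧ ¬ g e.2 := by
      ext e
      simp only [Finset.mem_erase, Finset.mem_union, Finset.mem_filter]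
      constructor
      · rintro ⟨h1, h2⟩
        have := hg' e h2 h1
        tauto
      · rintro (⟨h1, h2, h3⟩ | ⟨h1, h2, h3⟩) <;> refine ⟨?_, h1⟩ <;> rintro rfl <;> tauto
    have hdisj : Disjoint (D.filter fun e => g e.1 ∧ g e.2)
        (D.filter fun e => ¬ g e.1 ∧ ¬ g e.2) := by
      rw [Finset.disjoint_left]
      intro e h1 h2
      exact (Finset.mem_filter.1 h2).2.1 (Finset.mem_filter.1 h1).2.1
    have hDc : D.card = (D.filter fun e => g e.1 ∧ g e.2).card +
        (D.filter fun e => ¬ g e.1 ∧ ¬ g e.2).card + 1 := by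
      rw [← Finset.card_union_of_disjoint hdisj, ← hedges, Finset.card_erase_add_one hε]
    have hfc : (D.filter fun e => ¬ (e.1 ∈ P ∧ e.2 ∈ P)).card =
        ((D.filter fun e => g e.1 ∧ g e.2).filter fun e => ¬ (e.1 ∈ P ∧ e.2 ∈ P)).card +
        ((D.filter fun e => ¬ g e.1 ∧ ¬ g e.2).filter fun e => ¬ (e.1 ∈ P ∧ e.2 ∈ P)).card +
        if ε.1 ∈ P ∧ ε.2 ∈ P then 0 else 1 := by
      rw [← Finset.card_union_of_disjoint (Finset.disjoint_filter_filter hdisj),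
        ← Finset.filter_union, ← hedges, Finset.filter_erase]
      split_ifs with hP
      · rw [Finset.erase_eq_of_notMem (by simp [hP]), add_zero]
      · rw [Finset.card_erase_add_one (Finset.mem_filter.2 ⟨hε, hP⟩)]
    have hT := hcard T
    have hPc := hcard P
    constructor
    · by_cases hP : ε.1 ∈ P ∧ ε.2 ∈ P
      · rw [if_pos hP] at hfc
        omega
      · rw [if_neg hP] at hfc
        have f1 := Finset.card_filter_le (D.filter fun e => g e.1 ∧ g e.2)
          fun e => ¬ (e.1 ∈ P ∧ e.2 ∈ P)
        have f2 := Finset.card_filter_le (D.filter fun e => ¬ g e.1 ∧ ¬ g e.2)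
          fun e => ¬ (e.1 ∈ P ∧ e.2 ∈ P)
        rcases (S.filter g ∩ P).eq_empty_or_nonempty with h0 | ⟨u, hu⟩
        · have := a2 hAne h0
          rw [h0, Finset.card_empty] at hPc
          omega
        rcases ((S.filter fun v => ¬ g v) ∩ P).eq_empty_or_nonempty with h0 | ⟨w, hw⟩
        · have := b2 hBne h0
          rw [h0, Finset.card_empty] at hPc
          omega
        exfalso
        simp only [Finset.mem_inter, Finset.mem_filter] at hu hw
        obtain ⟨⟨u1, u2⟩, u3⟩ := hu
        obtain ⟨⟨w1, w2⟩, w3⟩ := hw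
        have hne : u ≠ w := by rintro rfl; exact w2 u2
        rcases h.joined u u3 w w3 hne with hj | hj
        · have hj' := hPD _ hj u1 w1 u3 w3
          by_cases he : (u, w) = ε
          · exact hP (he ▸ ⟨u3, w3⟩)
          · exact w2 ((hg' _ hj' he).1 u2)
        · have hj' := hPD _ hj w1 u1 w3 u3
          by_cases he : (w, u) = ε
          · exact hP (he ▸ ⟨w3, u3⟩)
          · exact w2 ((hg' _ hj' he).2 u2)
    · intro _ hSP
      have h1 := a2 hAne (by
        rw [Finset.filter_inter, hSP, Finset.filter_empty])
      have h2 := b2 hBne (by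
        rw [Finset.filter_inter, hSP, Finset.filter_empty])
      omega
  push Not at hbr
  obtain ⟨c1, c2⟩ := h.card_le_of_bridgeless hS hD hDS (fun v hv => by
    obtain ⟨e, he, hev⟩ := hiso v hv
    exact ⟨e, he, or_iff_not_imp_left.2 hev⟩) hbr
  have f1 := Finset.card_filter_le D fun e => ¬ (e.1 ∈ P ∧ e.2 ∈ P)
  refine ⟨?_, fun _ _ => by omega⟩
  rcases le_or_gt (S ∩ P).card 1 with h1 | h1
  · omega
  · obtain ⟨u, hu, w, hw, huw⟩ := Finset.one_lt_card.1 h1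
    have h2 : (S ∩ P).card ≤ 2 := (Finset.card_le_card Finset.inter_subset_right).trans h.card_le
    rw [Finset.mem_inter] at hu hw
    obtain ⟨e, he, he1, he2⟩ : ∃ e ∈ D, e.1 ∈ P ∧ e.2 ∈ P := by
      rcases h.joined u hu.2 w hw.2 huw with hj | hj
      · exact ⟨_, hPD _ hj hu.1 hw.1 hu.2 hw.2, hu.2, hw.2⟩
      · exact ⟨_, hPD _ hj hw.1 hu.1 hw.2 hu.2, hw.2, hu.2⟩
    have := c2 e he he1 he2
    have hlt : (D.filter fun e => ¬ (e.1 ∈ P ∧ e.2 ∈ P)).card < D.card :=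
      Finset.card_lt_card (Finset.filter_ssubset.2 ⟨e, he, by simp [he1, he2]⟩)
    omega

/-- The edges not joining two vertices of `P` can be directed so that no edge leaves a vertex
of `P`, at most one leaves each vertex of `T`, and at most two leave any other vertex. -/
theorem exists_orientation (h : Δ.ShortLists F T P) :
    ∃ τ : V × V → V,
      (∀ e ∈ Δ.D, ¬ (e.1 ∈ P ∧ e.2 ∈ P) → τ e = e.1 ∨ τ e = e.2) ∧
      ∀ v, ((Δ.D.filter fun e => ¬ (e.1 ∈ P ∧ e.2 ∈ P)).filter fun e => τ e = v).card ≤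
        if v ∈ P then 0 else if v ∈ T then 1 else 2 := by
  let w : V → ℕ := fun v => if v ∈ P then 0 else if v ∈ T then 1 else 2
  let slots : V → Finset (V × ℕ) := fun v => (Finset.range (w v)).map ⟨Prod.mk v, fun i j hij =>
    (Prod.mk.inj hij).2⟩
  have hslots : ∀ v x, x ∈ slots v ↔ x.1 = v ∧ x.2 < w v := by
    rintro v ⟨u, i⟩
    simp only [slots, Finset.mem_map, Finset.mem_range]
    constructor
    · rintro ⟨j, hj, hji⟩
      obtain ⟨rfl, rfl⟩ := Prod.mk.inj hji
      exact ⟨rfl, hj⟩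
    · rintro ⟨rfl, hi⟩
      exact ⟨i, hi, rfl⟩
  let N := Δ.D.filter fun e => ¬ (e.1 ∈ P ∧ e.2 ∈ P)
  obtain ⟨f, hf, hft⟩ := (Finset.all_card_le_biUnion_card_iff_exists_injective
    (fun e : N => slots e.1.1 ∪ slots e.1.2)).1 (by
      intro s
      let s' : Finset (V × V) := s.map (Function.Embedding.subtype _)
      have hs' : ∀ e, e ∈ s' ↔ ∃ he : e ∈ N, ⟨e, he⟩ ∈ s := fun e => by simp [s']
      let S : Finset V := s'.biUnion fun e => {e.1, e.2}
      have hS : ∀ e ∈ s', e.1 ∈ S ∧ e.2 ∈ S := fun e he =>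
        ⟨Finset.mem_biUnion.2 ⟨e, he, by simp⟩, Finset.mem_biUnion.2 ⟨e, he, by simp⟩⟩
      let D := Δ.D.filter fun e => e ∈ s' ∨ (e.1 ∈ P ∧ e.2 ∈ P ∧ e.1 ∈ S ∧ e.2 ∈ S)
      have hD := (h.card_le_two_mul S D (Finset.filter_subset _ _) (fun e he => by
        rcases (Finset.mem_filter.1 he).2 with h | h
        · exact hS e h
        · exact h.2.2) fun e he h1 h2 h3 h4 => Finset.mem_filter.2 ⟨he, Or.inr ⟨h3, h4, h1, h2⟩⟩).1
      have hsD : s' ⊆ D.filter fun e => ¬ (e.1 ∈ P ∧ e.2 ∈ P) := fun e he => by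
        obtain ⟨heN, -⟩ := (hs' e).1 he
        obtain ⟨heD, heP⟩ := Finset.mem_filter.1 heN
        exact Finset.mem_filter.2 ⟨Finset.mem_filter.2 ⟨heD, Or.inl he⟩, heP⟩
      have hsc : s.card ≤ (D.filter fun e => ¬ (e.1 ∈ P ∧ e.2 ∈ P)).card := by
        rw [← Finset.card_map (Function.Embedding.subtype (· ∈ N))]
        exact Finset.card_le_card hsD
      have hun : S.biUnion slots ⊆ s.biUnion fun e : N => slots e.1.1 ∪ slots e.1.2 := by
        intro x hx
        obtain ⟨v, hv, hx⟩ := Finset.mem_biUnion.1 hx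
        obtain ⟨e, he, hv⟩ := Finset.mem_biUnion.1 hv
        obtain ⟨heN, hes⟩ := (hs' e).1 he
        refine Finset.mem_biUnion.2 ⟨⟨e, heN⟩, hes, ?_⟩
        rw [Finset.mem_insert, Finset.mem_singleton] at hv
        rcases hv with rfl | rfl
        · exact Finset.mem_union_left _ hx
        · exact Finset.mem_union_right _ hx
      have hdis : (S : Set V).PairwiseDisjoint slots := fun u _ v _ huv =>
        Finset.disjoint_left.2 fun x h1 h2 => huv (((hslots _ _).1 h1).1.symm.trans
          ((hslots _ _).1 h2).1)
      have hcard : (S.biUnion slots).card = ∑ v ∈ S, w v := by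
        rw [Finset.card_biUnion hdis]
        exact Finset.sum_congr rfl fun v _ => by simp [slots]
      have hw : ∑ v ∈ S, w v + (S ∩ T).card + 2 * (S ∩ P).card = 2 * S.card := by
        have e1 : (S ∩ T).card = ∑ v ∈ S, if v ∈ T then 1 else 0 := by
          rw [Finset.sum_ite_mem, Finset.sum_const, smul_eq_mul, mul_one]
        have e2 : (S ∩ P).card = ∑ v ∈ S, if v ∈ P then 1 else 0 := by
          rw [Finset.sum_ite_mem, Finset.sum_const, smul_eq_mul, mul_one]
        rw [e1, e2, Finset.mul_sum, ← Finset.sum_add_distrib, ← Finset.sum_add_distrib,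
          mul_comm, ← smul_eq_mul, ← Finset.sum_const]
        refine Finset.sum_congr rfl fun v _ => ?_
        have : v ∈ T → v ∉ P := fun h1 h2 => Finset.disjoint_left.1 h.disjoint h1 h2
        by_cases h1 : v ∈ T
        · simp [w, h1, this h1]
        · by_cases h2 : v ∈ P <;> simp [w, h1, h2]
      have := Finset.card_le_card hun
      omega)
  refine ⟨fun e => if he : e ∈ N then (f ⟨e, he⟩).1 else e.1, fun e he heP => ?_, fun v => ?_⟩
  · have heN : e ∈ N := Finset.mem_filter.2 ⟨he, heP⟩
    simp only [heN, dif_pos]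
    rcases Finset.mem_union.1 (hft ⟨e, heN⟩) with h | h
    · exact Or.inl ((hslots _ _).1 h).1
    · exact Or.inr ((hslots _ _).1 h).1
  · change _ ≤ w v
    rw [← Finset.card_range (w v)]
    refine Finset.card_le_card_of_injOn (fun e => if he : e ∈ N then (f ⟨e, he⟩).2 else 0) ?_ ?_
    · intro e he
      obtain ⟨heN, hev⟩ := Finset.mem_filter.1 he
      have heN' : e ∈ N := heN
      simp only [heN', dif_pos] at hev ⊢
      rw [Finset.coe_range, Set.mem_Iio, ← hev]
      rcases Finset.mem_union.1 (hft ⟨e, heN⟩) with h | h <;>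
        · obtain ⟨h1, h2⟩ := (hslots _ _).1 h
          rwa [h1]
    · intro e he e' he' hee
      obtain ⟨heN, hev⟩ := Finset.mem_filter.1 he
      obtain ⟨heN', hev'⟩ := Finset.mem_filter.1 he'
      have h1 : e ∈ N := heN
      have h2 : e' ∈ N := heN'
      simp only [h1, h2, dif_pos] at hee hev hev'
      exact congrArg Subtype.val (hf (Prod.ext (hev.trans hev'.symm) hee))

end ShortLists

end Drawing

/-- The horizontal shear of the plane with parameter `t`. -/
def shear (t : ℝ) : ℝ × ℝ ≃ₜ ℝ × ℝ where
  toFun q := (q.1 + t * q.2, q.2)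
  invFun q := (q.1 - t * q.2, q.2)
  left_inv q := by simp
  right_inv q := by simp
  continuous_toFun := by fun_prop
  continuous_invFun := by fun_prop

lemma exists_shear_injective {V : Type} [Finite V] {pos : V → ℝ × ℝ}
    (hpos : Function.Injective pos) :
    ∃ t, Function.Injective fun v => (shear t (pos v)).1 := by
  have hfin : (range fun e : V × V =>
      -((pos e.1).1 - (pos e.2).1) / ((pos e.1).2 - (pos e.2).2)).Finite := finite_range _
  obtain ⟨t, ht⟩ := hfin.exists_notMem
  refine ⟨t, fun u v huv => hpos ?_⟩
  have huv' : (pos u).1 + t * (pos u).2 = (pos v).1 + t * (pos v).2 := huv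
  by_cases h2 : (pos u).2 = (pos v).2
  · rw [h2] at huv'
    exact Prod.ext (add_right_cancel huv') h2
  · refine absurd ⟨(u, v), ?_⟩ ht
    have : (pos u).2 - (pos v).2 ≠ 0 := sub_ne_zero.2 h2
    simp only
    rw [div_eq_iff this]
    linarith

namespace PlaneEmb
variable (E : PlaneEmb G) (t : ℝ)

lemma shear_symm_line_mem_seg {a b : V} {x : ℝ}
    (h : (shear t (E.pos a)).1 < (shear t (E.pos b)).1) (h1 : (shear t (E.pos a)).1 ≤ x)
    (h2 : x ≤ (shear t (E.pos b)).1) :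
    (shear t).symm (x, line (fun v => (shear t (E.pos v)).1) (fun v => (shear t (E.pos v)).2)
      (a, b) x) ∈ seg (E.pos a) (E.pos b) := by
  have h0 : 0 < (shear t (E.pos b)).1 - (shear t (E.pos a)).1 := sub_pos.2 h
  rw [seg, segment_eq_image]
  refine ⟨(x - (shear t (E.pos a)).1) / ((shear t (E.pos b)).1 - (shear t (E.pos a)).1),
    ⟨div_nonneg (by linarith) h0.le, (div_le_one h0).2 (by linarith)⟩, ?_⟩
  rw [Homeomorph.eq_symm_apply]
  have e : ∀ q : ℝ × ℝ, shear t q = (q.1 + t * q.2, q.2) := fun _ => rfl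
  simp only [e, line] at h0 ⊢
  have h0' := h0.ne'
  ext
  · simp only [Prod.fst_add, Prod.snd_add, Prod.smul_fst, Prod.smul_snd, smul_eq_mul]
    field_simp
    ring
  · simp only [Prod.snd_add, Prod.smul_snd, smul_eq_mul]
    field_simp
    ring

open Classical in
/-- The sheared drawing of a plane graph whose vertices get distinct abscissas. -/
noncomputable def sheared [Fintype V] (ht : Function.Injective fun v => (shear t (E.pos v)).1) :
    Drawing V where
  X v := (shear t (E.pos v)).1
  Y v := (shear t (E.pos v)).2
  D := Finset.univ.filter fun e => G.Adj e.1 e.2 ∧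
    (shear t (E.pos e.1)).1 < (shear t (E.pos e.2)).1
  inj := ht
  lt e he := (Finset.mem_filter.1 he).2.2
  meet e he e' he' hne x h1 h2 h3 h4 hx := by
    obtain ⟨-, ha, hl⟩ := Finset.mem_filter.1 he
    obtain ⟨-, ha', hl'⟩ := Finset.mem_filter.1 he'
    have hs : s(e.1, e.2) ≠ s(e'.1, e'.2) := by
      intro h
      rcases Sym2.eq_iff.1 h with ⟨p, q⟩ | ⟨p, q⟩
      · exact hne (Prod.ext p q)
      · rw [p, q] at hl
        exact lt_asymm hl hl'
    have hm := E.shear_symm_line_mem_seg t hl h1 h2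
    have hm' := E.shear_symm_line_mem_seg t hl' h3 h4
    change line _ _ (e.1, e.2) x = line _ _ (e'.1, e'.2) x at hx
    rw [hx] at hm
    have hX : ∀ {q : ℝ × ℝ} {v : V}, (shear t).symm q = E.pos v → q.1 = (shear t (E.pos v)).1 := by
      intro q v h
      rw [← h, Homeomorph.apply_symm_apply]
    obtain ⟨k1, k2⟩ := E.edges_meet ha ha' hs ⟨hm, hm'⟩
    exact ⟨k1.imp hX hX, k2.imp hX hX⟩

variable {E t}

lemma BoundaryEdge.symm {F : Set (ℝ × ℝ)} {u v : V} (h : E.BoundaryEdge F u v) :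
    E.BoundaryEdge F v u :=
  ⟨h.1.symm, by rw [seg, segment_symm]; exact h.2⟩

variable [Fintype V] {ht : Function.Injective fun v => (shear t (E.pos v)).1}

lemma mem_sheared {a b : V} : (a, b) ∈ (E.sheared t ht).D ↔
    G.Adj a b ∧ (shear t (E.pos a)).1 < (shear t (E.pos b)).1 := by
  simp [sheared]

lemma joined_sheared {a b : V} : (E.sheared t ht).Joined a b ↔ G.Adj a b := by
  rw [Drawing.Joined, mem_sheared, mem_sheared, G.adj_comm b a, ← and_or_left, and_iff_left_iff_imp]
  exact fun h => lt_or_gt_of_ne fun h' => h.ne (ht h')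

lemma shortLists_sheared (hC3 : ¬ HasCycleLen G 3) {F : Set (ℝ × ℝ)} (hF : E.IsOuterFace F)
    {T P : Finset V} (hTP : Disjoint T P) (hTi : ∀ u ∈ T, ∀ v ∈ T, ¬ G.Adj u v)
    (hTF : ∀ v ∈ T, v ∈ E.onFace F) (hP : P.card ≤ 2)
    (hPF : ∀ u ∈ P, ∀ v ∈ P, u ≠ v → E.BoundaryEdge F u v) :
    (E.sheared t ht).ShortLists (shear t '' F) T P := by
  obtain ⟨⟨q₀, hq₀, hFq⟩, hunb⟩ := hF
  have hsub : F ⊆ E.drawingᶜ := hFq ▸ connectedComponentIn_subset _ _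
  refine ⟨?_, ?_, ?_, ?_, hTP, ?_, ?_, hP, ?_, ?_⟩
  · rw [hFq]
    exact isPreconnected_connectedComponentIn.image _ (shear t).continuous.continuousOn
  · intro hb
    refine hunb ((hb.isCompact_closure.image (shear t).symm.continuous).isBounded.subset ?_)
    intro q hq
    exact ⟨shear t q, subset_closure (mem_image_of_mem _ hq), (shear t).symm_apply_apply q⟩
  · rintro _ ⟨q, hq, rfl⟩ ⟨a, b⟩ he h1 h2 hy
    obtain ⟨hab, hl⟩ := mem_sheared.1 he
    have : (shear t).symm ((shear t q).1, (E.sheared t ht).ht (a, b) (shear t q).1) ∈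
        seg (E.pos a) (E.pos b) := E.shear_symm_line_mem_seg t hl h1 h2
    rw [← hy, Prod.mk.eta, Homeomorph.symm_apply_apply] at this
    exact hsub hq (Or.inr (mem_iUnion.2 ⟨a, mem_iUnion.2 ⟨b, mem_iUnion.2 ⟨hab, this⟩⟩⟩))
  · intro a b c h1 h2 h3
    classical
    exact hC3 (SimpleGraph.is3Clique_iff_exists_cycle_length_three.1 ⟨_,
      SimpleGraph.is3Clique_iff.2 ⟨a, b, c, joined_sheared.1 h1, joined_sheared.1 h3,
        joined_sheared.1 h2, rfl⟩⟩)
  · rintro ⟨a, b⟩ he ⟨h1, h2⟩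
    exact hTi a h1 b h2 (mem_sheared.1 he).1
  · intro v hv
    rw [← Homeomorph.image_closure]
    exact ⟨_, hTF v hv, rfl⟩
  · exact fun u hu v hv huv => joined_sheared.2 (hPF u hu v hv huv).1
  · rintro ⟨a, b⟩ he ha hb x h1 h2
    obtain ⟨hab, hl⟩ := mem_sheared.1 he
    rw [← Homeomorph.image_closure]
    exact ⟨_, (hPF a ha b hb hab.ne).2 (E.shear_symm_line_mem_seg t hl h1 h2),
      (shear t).apply_symm_apply _⟩

end PlaneEmb

/-- **Theorem 5 of the paper.** Let `G` be a triangle-free plane graph with outer face `F`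
carrying a subpath `P` of (the boundary of) `F` with at most two vertices, and let `L` be
a `(*,1)`-list assignment satisfying conditions (i)–(v).  Then `G` is `L`-colorable. -/
theorem triangleFree_precolored_extension {V : Type} [Fintype V]
    (G : SimpleGraph V) (E : PlaneEmb G)
    (hC3 : ¬ HasCycleLen G 3)
    (F : Set (ℝ × ℝ)) (hF : E.IsOuterFace F)
    (P : List V) (hPnd : P.Nodup) (hPlen : P.length ≤ 2)
    (hPF : ∀ v ∈ P, v ∈ E.onFace F)
    (hPpath : P.Chain' (E.BoundaryEdge F))
    (L : V → Finset ℕ)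
    (hL1 : ∀ v, 1 ≤ (L v).card)
    (hsep : ∀ ⦃u v⦄, G.Adj u v → ((L u) ∩ (L v)).card ≤ 1)
    (hi : ∀ v, v ∉ E.onFace F → 3 ≤ (L v).card)
    (hii : ∀ v ∈ E.onFace F, v ∉ P → 2 ≤ (L v).card)
    (hiii : ∀ v ∈ P, (L v).card = 1)
    (hiv : ∀ ⦃u v⦄, G.Adj u v → (L u).card = 2 → (L v).card ≠ 2)
    (hv : ∃ φ : V → ℕ, (∀ v ∈ P, φ v ∈ L v) ∧
      ∀ ⦃u v⦄, u ∈ P → v ∈ P → G.Adj u v → φ u ≠ φ v) :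
    ColorableWith G L := by
  classical
  obtain ⟨t, ht⟩ := exists_shear_injective E.inj
  let T : Finset V := Finset.univ.filter fun v => (L v).card = 2
  have hT : ∀ v, v ∈ T ↔ (L v).card = 2 := fun v => by simp [T]
  have hPb : ∀ u ∈ P, ∀ v ∈ P, u ≠ v → E.BoundaryEdge F u v := by
    match P, hPlen, hPpath with
    | [], _, _ => simp
    | [a], _, _ => simp +contextual
    | [a, b], _, h =>
      have hab : E.BoundaryEdge F a b := List.isChain_pair.1 h
      intro u hu v hv huv
      simp only [List.mem_cons, List.not_mem_nil, or_false] at hu hv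
      rcases hu with rfl | rfl <;> rcases hv with rfl | rfl
      · exact absurd rfl huv
      · exact hab
      · exact hab.symm
      · exact absurd rfl huv
  have h : (E.sheared t ht).ShortLists (shear t '' F) T P.toFinset := by
    refine PlaneEmb.shortLists_sheared hC3 hF ?_ ?_ ?_ ?_ ?_
    · refine Finset.disjoint_left.2 fun v h1 h2 => ?_
      have := (hT v).1 h1
      have := hiii v (List.mem_toFinset.1 h2)
      omega
    · exact fun u hu v hv huv => hiv huv ((hT u).1 hu) ((hT v).1 hv)
    · intro v hv
      by_contra h
      have := (hT v).1 hv
      have := hi v h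
      omega
    · exact (List.toFinset_card_le P).trans hPlen
    · exact fun u hu v hv => hPb u (List.mem_toFinset.1 hu) v (List.mem_toFinset.1 hv)
  obtain ⟨τ, hτ, hτc⟩ := h.exists_orientation
  set N := (E.sheared t ht).D.filter fun e => ¬ (e.1 ∈ P.toFinset ∧ e.2 ∈ P.toFinset) with hN
  have hcol : ∀ v, ∃ c ∈ L v, c ∉ (N.filter fun e => τ e = v).biUnion fun e => L e.1 ∩ L e.2 := by
    intro v
    refine Finset.exists_mem_notMem_of_card_lt_card (lt_of_le_of_lt (b := (N.filter fun e =>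
      τ e = v).card * 1) (Finset.card_biUnion_le_card_mul _ _ _ fun e he => ?_) ?_)
    · exact hsep (PlaneEmb.mem_sheared.1 (Finset.mem_filter.1 (Finset.mem_filter.1 he).1).1).1
    · rw [mul_one]
      refine (hτc v).trans_lt ?_
      split_ifs with h1 h2
      · exact hL1 v
      · rw [(hT v).1 h2]
        exact one_lt_two
      · rw [List.mem_toFinset] at h1
        rw [hT] at h2
        by_cases h3 : v ∈ E.onFace F
        · have := hii v h3 h1
          omega
        · exact hi v h3
  choose φ hφ hφN using hcol
  refine ⟨φ, hφ, ?_⟩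
  have main : ∀ u v, (u, v) ∈ (E.sheared t ht).D → φ u ≠ φ v := by
    intro u v he huv
    by_cases hP : u ∈ P ∧ v ∈ P
    · obtain ⟨ψ, hψ, hψ'⟩ := hv
      have heq : ∀ w ∈ P, φ w = ψ w := fun w hw =>
        Finset.card_le_one.1 (hiii w hw).le _ (hφ w) _ (hψ w hw)
      exact hψ' hP.1 hP.2 (PlaneEmb.mem_sheared.1 he).1 (by rw [← heq u hP.1, ← heq v hP.2, huv])
    · have hP' : ¬ (u ∈ P.toFinset ∧ v ∈ P.toFinset) := by simpa using hP
      have heN : (u, v) ∈ N := Finset.mem_filter.2 ⟨he, hP'⟩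
      rcases hτ _ he hP' with h | h
      · exact hφN u (Finset.mem_biUnion.2 ⟨_, Finset.mem_filter.2 ⟨heN, h⟩,
          Finset.mem_inter.2 ⟨hφ u, huv ▸ hφ v⟩⟩)
      · exact hφN v (Finset.mem_biUnion.2 ⟨_, Finset.mem_filter.2 ⟨heN, h⟩,
          Finset.mem_inter.2 ⟨huv ▸ hφ u, hφ v⟩⟩)
  intro u v huv
  rcases PlaneEmb.joined_sheared.2 huv with h | h
  · exact main u v h
  · exact (main v u h).symm

end ChoosSep
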